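/- arXiv:2407.16416 — 2 statements merged into one kernel-verified Lean document; each statement's English description precedes it below -/
import Mathlib

section
/- Let X ⊂ ℝ^d be a relatively separated set and ν an admissible weight satisfying the weak growth condition ν(x) ≥ C₀ (1+|x|)^δ for some δ ∈ (0,1] and C₀ > 0. Then: (i) for every self-adjoint B(H)-valued matrix A (A_{l,k} = A_{k,l}^* for all k,l) with finite Schur norm ‖A‖_{S_ν^1} < ∞, one has lim_{n→∞} ‖A^n‖_{S_ν^1}^{1/n} = r(A), the spectral radius of the bounded operator on ℓ²(X;H) defined by A; and (ii) S_ν^1(X) is inverse-closed in B(ℓ²(X;H)): if A has finite S_ν^1 norm and the operator it defines on ℓ²(X;H) is invertible, then the canonical matrix representation of the inverse also has finite S_ν^1 norm. -/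
open scoped ENNReal NNReal
open Set Filter

noncomputable section

/-- `ℝ^d` with the Euclidean norm. -/
abbrev Euc (d : ℕ) := EuclideanSpace ℝ (Fin d)

/-- A set `X ⊂ ℝ^d` is relatively separated if
`sup_{x ∈ ℝ^d} #(X ∩ (x + [0,1]^d)) < ∞`. -/
def RelSep {d : ℕ} (X : Set (Euc d)) : Prop :=
  ∃ N : ℕ, ∀ x : Euc d,
    (X ∩ {y | ∀ j, x j ≤ y j ∧ y j ≤ x j + 1}).Finite ∧
    (X ∩ {y | ∀ j, x j ≤ y j ∧ y j ≤ x j + 1}).ncard ≤ N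

/-- A function `nrm : ℝ^d → ℝ` is a norm on `ℝ^d`. -/
def IsNormOn {d : ℕ} (nrm : Euc d → ℝ) : Prop :=
  (∀ x, 0 ≤ nrm x) ∧ (∀ x, nrm x = 0 ↔ x = 0) ∧
  (∀ (c : ℝ) (x), nrm (c • x) = |c| * nrm x) ∧
  (∀ x y, nrm (x + y) ≤ nrm x + nrm y)

/-- An admissible weight: `ν(x) = e^{ρ(‖x‖)}` for some continuous concave
`ρ : [0,∞) → [0,∞)` with `ρ(0) = 0` and some norm `‖·‖` on `ℝ^d`, and `ν`
satisfies the GRS-condition. -/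
def Admissible {d : ℕ} (ν : Euc d → ℝ) : Prop :=
  (∃ (ρ : ℝ → ℝ) (nrm : Euc d → ℝ), IsNormOn nrm ∧
      ContinuousOn ρ (Set.Ici 0) ∧ ConcaveOn ℝ (Set.Ici 0) ρ ∧ ρ 0 = 0 ∧
      (∀ t ∈ Set.Ici (0 : ℝ), 0 ≤ ρ t) ∧ (∀ x, ν x = Real.exp (ρ (nrm x)))) ∧
  (∀ z : Euc d, Tendsto (fun n : ℕ => (ν ((n : ℝ) • z)) ^ (1 / (n : ℝ)))
    atTop (nhds 1))

/-- Membership in the Schur class `S_ν^1(X)`. -/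
def MemSchur1 {d : ℕ} {X : Set (Euc d)} {H : Type*}
    [NormedAddCommGroup H] [InnerProductSpace ℂ H]
    (ν : Euc d → ℝ) (A : ↥X → ↥X → (H →L[ℂ] H)) : Prop :=
  (∀ k : ↥X, Summable fun l : ↥X => ‖A k l‖ * ν ((k : Euc d) - (l : Euc d))) ∧
  BddAbove (Set.range fun k : ↥X => ∑' l : ↥X, ‖A k l‖ * ν ((k : Euc d) - (l : Euc d))) ∧
  (∀ l : ↥X, Summable fun k : ↥X => ‖A k l‖ * ν ((k : Euc d) - (l : Euc d))) ∧
  BddAbove (Set.range fun l : ↥X => ∑' k : ↥X, ‖A k l‖ * ν ((k : Euc d) - (l : Euc d)))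

/-- The Schur norm `‖A‖_{S_ν^1}`. -/
noncomputable def schurNorm1 {d : ℕ} {X : Set (Euc d)} {H : Type*}
    [NormedAddCommGroup H] [InnerProductSpace ℂ H]
    (ν : Euc d → ℝ) (A : ↥X → ↥X → (H →L[ℂ] H)) : ℝ :=
  max (⨆ k : ↥X, ∑' l : ↥X, ‖A k l‖ * ν ((k : Euc d) - (l : Euc d)))
      (⨆ l : ↥X, ∑' k : ↥X, ‖A k l‖ * ν ((k : Euc d) - (l : Euc d)))

/-- The matrix product `[AB]_{k,l} = Σ_n A_{k,n} B_{n,l}`. -/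
noncomputable def matMul {X : Type*} {H : Type*}
    [NormedAddCommGroup H] [InnerProductSpace ℂ H] [CompleteSpace H]
    (A B : X → X → (H →L[ℂ] H)) : X → X → (H →L[ℂ] H) :=
  fun k l => ∑' n : X, (A k n) ∘L (B n l)

/-- `matPow A n` is the matrix power `A^(n+1)`. -/
noncomputable def matPow {X : Type*} {H : Type*}
    [NormedAddCommGroup H] [InnerProductSpace ℂ H] [CompleteSpace H]
    (A : X → X → (H →L[ℂ] H)) : ℕ → (X → X → (H →L[ℂ] H))
  | 0 => A
  | n + 1 => matMul (matPow A n) A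

/-- The sequence `δ_l f ∈ ℓ^p(X;H)` equal to `f` at index `l` and `0` elsewhere. -/
noncomputable def deltaSeq {X : Type*} {H : Type*} [NormedAddCommGroup H]
    (p : ℝ≥0∞) (l : X) (f : H) : lp (fun _ : X => H) p :=
  haveI := Classical.decEq X
  lp.single p l f

/-! ### Operator-valued matrices of bounded operators on `ℓ²(ι; H)` -/

section Entries

variable {ι H : Type*} [NormedAddCommGroup H]

/-- The Hilbert space `ℓ²(ι; H)`. -/
abbrev EllTwo (ι H : Type*) [NormedAddCommGroup H] := lp (fun _ : ι => H) 2

lemma deltaSeq_apply_self (l : ι) (f : H) : deltaSeq 2 l f l = f := by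
  classical
  simp [deltaSeq]

lemma deltaSeq_apply_ne {k l : ι} (h : k ≠ l) (f : H) : deltaSeq 2 l f k = 0 := by
  classical
  simp [deltaSeq, Pi.single_eq_of_ne h]

lemma norm_deltaSeq (l : ι) (f : H) : ‖deltaSeq 2 l f‖ = ‖f‖ := by
  classical
  exact lp.norm_single (E := fun _ : ι => H) (p := 2) (by norm_num) l f

lemma deltaSeq_add (l : ι) (f g : H) :
    deltaSeq 2 l (f + g) = deltaSeq 2 l f + deltaSeq 2 l g := by
  classical
  exact lp.single_add _ _ _ _

lemma norm_coord_le (f : EllTwo ι H) (k : ι) : ‖f k‖ ≤ ‖f‖ :=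
  lp.norm_apply_le_norm (by norm_num) f k

lemma EllTwo.enorm_sq_eq_tsum (f : EllTwo ι H) : ‖f‖ₑ ^ 2 = ∑' k, ‖f k‖ₑ ^ 2 := by
  have h := lp.hasSum_norm (p := 2) (by norm_num) f
  simp only [ENNReal.toReal_ofNat, Real.rpow_ofNat] at h
  have h2 := ENNReal.ofReal_tsum_of_nonneg (fun k => sq_nonneg ‖f k‖) h.summable
  rw [h.tsum_eq] at h2
  simpa only [ENNReal.ofReal_pow (norm_nonneg _), ofReal_norm] using h2

variable [InnerProductSpace ℂ H]

lemma deltaSeq_smul (l : ι) (c : ℂ) (f : H) : deltaSeq 2 l (c • f) = c • deltaSeq 2 l f := by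
  classical
  exact lp.single_smul _ _ _ _

/-- The coordinate functional `f ↦ f k` on `ℓ²(ι; H)`. -/
def coordCLM (k : ι) : EllTwo ι H →L[ℂ] H :=
  LinearMap.mkContinuous { toFun := fun f => f k, map_add' := by simp, map_smul' := by simp } 1
    (fun f => (norm_coord_le f k).trans_eq (one_mul _).symm)

@[simp] lemma coordCLM_apply (k : ι) (f : EllTwo ι H) : coordCLM k f = f k := rfl

/-- The canonical matrix of a bounded operator on `ℓ²(ι; H)`. -/
def entry (T : EllTwo ι H →L[ℂ] EllTwo ι H) (k l : ι) : H →L[ℂ] H :=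
  LinearMap.mkContinuous
    { toFun := fun f => T (deltaSeq 2 l f) k
      map_add' := by simp [deltaSeq_add]
      map_smul' := by simp [deltaSeq_smul] } ‖T‖
    (fun f => by
      have h := T.le_opNorm (deltaSeq 2 l f)
      rw [norm_deltaSeq] at h
      exact (norm_coord_le _ k).trans h)

@[simp] lemma entry_apply (T : EllTwo ι H →L[ℂ] EllTwo ι H) (k l : ι) (f : H) :
    entry T k l f = T (deltaSeq 2 l f) k := rfl

lemma norm_entry_le (T : EllTwo ι H →L[ℂ] EllTwo ι H) (k l : ι) : ‖entry T k l‖ ≤ ‖T‖ :=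
  LinearMap.mkContinuous_norm_le _ (norm_nonneg T) _

lemma enorm_entry_le (T : EllTwo ι H →L[ℂ] EllTwo ι H) (k l : ι) : ‖entry T k l‖ₑ ≤ ‖T‖ₑ :=
  enorm_le_iff_norm_le.2 (norm_entry_le T k l)

lemma entry_add (S T : EllTwo ι H →L[ℂ] EllTwo ι H) (k l : ι) :
    entry (S + T) k l = entry S k l + entry T k l := by
  ext f; simp

lemma entry_sub (S T : EllTwo ι H →L[ℂ] EllTwo ι H) (k l : ι) :
    entry (S - T) k l = entry S k l - entry T k l := by
  ext f; simp

lemma entry_smul (c : ℂ) (T : EllTwo ι H →L[ℂ] EllTwo ι H) (k l : ι) :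
    entry (c • T) k l = c • entry T k l := by
  ext f; simp

lemma hasSum_entry (T : EllTwo ι H →L[ℂ] EllTwo ι H) (f : EllTwo ι H) (k : ι) :
    HasSum (fun l => entry T k l (f l)) (T f k) := by
  classical
  have h : HasSum (fun l => deltaSeq 2 l (f l)) f := by
    convert lp.hasSum_single (by norm_num : (2 : ℝ≥0∞) ≠ ⊤) f using 2
    unfold deltaSeq
    congr!
  exact (h.mapL T).mapL (coordCLM k)

lemma enorm_entry_mul_le (S T : EllTwo ι H →L[ℂ] EllTwo ι H) (k l : ι) :
    ‖entry (S * T) k l‖ₑ ≤ ∑' n, ‖entry S k n‖ₑ * ‖entry T n l‖ₑ := by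
  refine ContinuousLinearMap.opENorm_le_bound _ fun f => ?_
  have h := hasSum_entry S (T (deltaSeq 2 l f)) k
  calc ‖entry (S * T) k l f‖ₑ = ‖∑' n, entry S k n (entry T n l f)‖ₑ := by
        exact congrArg _ h.tsum_eq.symm
    _ ≤ ∑' n, ‖entry S k n (entry T n l f)‖ₑ := by
        exact enorm_tsum_le_tsum_enorm
    _ ≤ ∑' n, ‖entry S k n‖ₑ * ‖entry T n l‖ₑ * ‖f‖ₑ := by
        refine ENNReal.tsum_le_tsum fun n => ?_
        rw [mul_assoc]
        exact (ContinuousLinearMap.le_opENorm _ _).trans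
          (by gcongr; exact ContinuousLinearMap.le_opENorm _ _)
    _ = _ := ENNReal.tsum_mul_right

lemma entry_adjoint [CompleteSpace H] (T : EllTwo ι H →L[ℂ] EllTwo ι H) (k l : ι) :
    entry (ContinuousLinearMap.adjoint T) k l = ContinuousLinearMap.adjoint (entry T l k) := by
  classical
  rw [ContinuousLinearMap.eq_adjoint_iff]
  intro f g
  have h1 := lp.inner_single_right (𝕜 := ℂ) k g (ContinuousLinearMap.adjoint T (lp.single 2 l f))
  have h2 := lp.inner_single_left (𝕜 := ℂ) l f (T (lp.single 2 k g))
  rw [ContinuousLinearMap.adjoint_inner_left] at h1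
  have hl : deltaSeq 2 l f = lp.single 2 l f := by unfold deltaSeq; congr!
  have hk : deltaSeq 2 k g = lp.single 2 k g := by unfold deltaSeq; congr!
  rw [entry_apply, entry_apply, hl, hk, ← h2, ← h1]

end Entries
/-! ### Weighted Schur norms with values in `[0, ∞]` -/

section Schur

variable {ι H : Type*} [NormedAddCommGroup H] [InnerProductSpace ℂ H]

/-- The Schur norm with weight `W`, as an extended nonnegative real. -/
def eSchur (W : ι → ι → ℝ≥0∞) (A : ι → ι → (H →L[ℂ] H)) : ℝ≥0∞ :=
  max (⨆ k, ∑' l, ‖A k l‖ₑ * W k l) (⨆ l, ∑' k, ‖A k l‖ₑ * W k l)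

lemma eSchur_le_iff {W : ι → ι → ℝ≥0∞} {A : ι → ι → (H →L[ℂ] H)} {c : ℝ≥0∞} :
    eSchur W A ≤ c ↔
      (∀ k, ∑' l, ‖A k l‖ₑ * W k l ≤ c) ∧ ∀ l, ∑' k, ‖A k l‖ₑ * W k l ≤ c := by
  simp [eSchur]

lemma row_le_eSchur (W : ι → ι → ℝ≥0∞) (A : ι → ι → (H →L[ℂ] H)) (k : ι) :
    ∑' l, ‖A k l‖ₑ * W k l ≤ eSchur W A :=
  (eSchur_le_iff.1 le_rfl).1 k

lemma col_le_eSchur (W : ι → ι → ℝ≥0∞) (A : ι → ι → (H →L[ℂ] H)) (l : ι) :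
    ∑' k, ‖A k l‖ₑ * W k l ≤ eSchur W A :=
  (eSchur_le_iff.1 le_rfl).2 l

lemma eSchur_le_of_weight_le {W W₁ W₂ : ι → ι → ℝ≥0∞} {a b : ℝ≥0∞}
    (h : ∀ k l, W k l ≤ a * W₁ k l + b * W₂ k l) (A : ι → ι → (H →L[ℂ] H)) :
    eSchur W A ≤ a * eSchur W₁ A + b * eSchur W₂ A := by
  have key : ∀ k l, ‖A k l‖ₑ * W k l
      ≤ a * (‖A k l‖ₑ * W₁ k l) + b * (‖A k l‖ₑ * W₂ k l) := fun k l => by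
    calc _ ≤ ‖A k l‖ₑ * (a * W₁ k l + b * W₂ k l) := by gcongr; exact h k l
      _ = _ := by ring
  rw [eSchur_le_iff]
  refine ⟨fun k => ?_, fun l => ?_⟩
  · refine (ENNReal.tsum_le_tsum fun l => key k l).trans ?_
    rw [ENNReal.tsum_add, ENNReal.tsum_mul_left, ENNReal.tsum_mul_left]
    gcongr <;> exact row_le_eSchur _ _ _
  · refine (ENNReal.tsum_le_tsum fun k => key k l).trans ?_
    rw [ENNReal.tsum_add, ENNReal.tsum_mul_left, ENNReal.tsum_mul_left]
    gcongr <;> exact col_le_eSchur _ _ _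

lemma eSchur_le_of_weight_le_mul {W W₁ : ι → ι → ℝ≥0∞} {a : ℝ≥0∞}
    (h : ∀ k l, W k l ≤ a * W₁ k l) (A : ι → ι → (H →L[ℂ] H)) :
    eSchur W A ≤ a * eSchur W₁ A := by
  simpa using eSchur_le_of_weight_le (W₂ := W₁) (b := 0) (by simpa using h) A

lemma eSchur_entry_add_le (W : ι → ι → ℝ≥0∞) (S T : EllTwo ι H →L[ℂ] EllTwo ι H) :
    eSchur W (entry (S + T)) ≤ eSchur W (entry S) + eSchur W (entry T) := by
  have key : ∀ k l, ‖entry (S + T) k l‖ₑ * W k l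
      ≤ ‖entry S k l‖ₑ * W k l + ‖entry T k l‖ₑ * W k l := fun k l => by
    rw [entry_add, ← add_mul]
    gcongr
    exact enorm_add_le (entry S k l) (entry T k l)
  rw [eSchur_le_iff]
  refine ⟨fun k => ?_, fun l => ?_⟩
  · refine (ENNReal.tsum_le_tsum fun l => key k l).trans ?_
    rw [ENNReal.tsum_add]
    gcongr <;> exact row_le_eSchur _ _ _
  · refine (ENNReal.tsum_le_tsum fun k => key k l).trans ?_
    rw [ENNReal.tsum_add]
    gcongr <;> exact col_le_eSchur _ _ _

lemma eSchur_entry_smul (W : ι → ι → ℝ≥0∞) (c : ℂ) (T : EllTwo ι H →L[ℂ] EllTwo ι H) :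
    eSchur W (entry (c • T)) ≤ ‖c‖ₑ * eSchur W (entry T) := by
  have key : ∀ k l, ‖entry (c • T) k l‖ₑ * W k l = ‖c‖ₑ * (‖entry T k l‖ₑ * W k l) :=
    fun k l => by rw [entry_smul, enorm_smul, mul_assoc]
  simp only [eSchur_le_iff, key, ENNReal.tsum_mul_left]
  exact ⟨fun k => by gcongr; exact row_le_eSchur _ _ _, fun l => by
    gcongr; exact col_le_eSchur _ _ _⟩

lemma eSchur_entry_zero (W : ι → ι → ℝ≥0∞) :
    eSchur W (entry (0 : EllTwo ι H →L[ℂ] EllTwo ι H)) = 0 := by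
  simpa using eSchur_entry_smul W 0 (0 : EllTwo ι H →L[ℂ] EllTwo ι H)

lemma eSchur_entry_sum_le (W : ι → ι → ℝ≥0∞) (T : ℕ → EllTwo ι H →L[ℂ] EllTwo ι H) (n : ℕ) :
    eSchur W (entry (∑ i ∈ Finset.range n, T i))
      ≤ ∑ i ∈ Finset.range n, eSchur W (entry (T i)) := by
  induction n with
  | zero => simp [eSchur_entry_zero]
  | succ n ih =>
    rw [Finset.sum_range_succ, Finset.sum_range_succ]
    exact (eSchur_entry_add_le _ _ _).trans (by gcongr)

lemma eSchur_entry_one_le {W : ι → ι → ℝ≥0∞} (hW : ∀ k, W k k ≤ 1) :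
    eSchur W (entry (1 : EllTwo ι H →L[ℂ] EllTwo ι H)) ≤ 1 := by
  have hne : ∀ {k l : ι}, k ≠ l → ‖entry (1 : EllTwo ι H →L[ℂ] EllTwo ι H) k l‖ₑ = 0 := by
    intro k l h
    have h0 : entry (1 : EllTwo ι H →L[ℂ] EllTwo ι H) k l = 0 := by
      ext f
      exact deltaSeq_apply_ne h f
    rw [h0, ← ofReal_norm, norm_zero, ENNReal.ofReal_zero]
  have heq : ∀ k : ι, ‖entry (1 : EllTwo ι H →L[ℂ] EllTwo ι H) k k‖ₑ * W k k ≤ 1 := fun k => by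
    refine mul_le_one' (ContinuousLinearMap.opENorm_le_bound _ fun f => ?_) (hW k)
    rw [entry_apply, one_mul]
    exact (congrArg _ (deltaSeq_apply_self k f)).le
  rw [eSchur_le_iff]
  refine ⟨fun k => ?_, fun l => ?_⟩
  · rw [tsum_eq_single k fun l h => by rw [hne h.symm, zero_mul]]
    exact heq k
  · rw [tsum_eq_single l fun k h => by rw [hne h, zero_mul]]
    exact heq l

lemma eSchur_entry_mul_le {W : ι → ι → ℝ≥0∞} (hW : ∀ k n l, W k l ≤ W k n * W n l)
    (S T : EllTwo ι H →L[ℂ] EllTwo ι H) :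
    eSchur W (entry (S * T)) ≤ eSchur W (entry S) * eSchur W (entry T) := by
  have key : ∀ k l, ‖entry (S * T) k l‖ₑ * W k l
      ≤ ∑' n, (‖entry S k n‖ₑ * W k n) * (‖entry T n l‖ₑ * W n l) := fun k l => by
    calc _ ≤ (∑' n, ‖entry S k n‖ₑ * ‖entry T n l‖ₑ) * W k l := by
          gcongr; exact enorm_entry_mul_le S T k l
      _ = ∑' n, ‖entry S k n‖ₑ * ‖entry T n l‖ₑ * W k l := ENNReal.tsum_mul_right.symm
      _ ≤ _ := by
          refine ENNReal.tsum_le_tsum fun n => ?_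
          calc _ ≤ ‖entry S k n‖ₑ * ‖entry T n l‖ₑ * (W k n * W n l) := by
                gcongr; exact hW k n l
            _ = _ := by ring
  rw [eSchur_le_iff]
  refine ⟨fun k => ?_, fun l => ?_⟩
  · calc _ ≤ ∑' l, ∑' n, (‖entry S k n‖ₑ * W k n) * (‖entry T n l‖ₑ * W n l) :=
          ENNReal.tsum_le_tsum fun l => key k l
      _ = ∑' n, (‖entry S k n‖ₑ * W k n) * ∑' l, (‖entry T n l‖ₑ * W n l) := by
          rw [ENNReal.tsum_comm]; simp only [ENNReal.tsum_mul_left]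
      _ ≤ ∑' n, (‖entry S k n‖ₑ * W k n) * eSchur W (entry T) :=
          ENNReal.tsum_le_tsum fun n => by gcongr; exact row_le_eSchur _ _ _
      _ ≤ _ := by rw [ENNReal.tsum_mul_right]; gcongr; exact row_le_eSchur _ _ _
  · calc _ ≤ ∑' k, ∑' n, (‖entry S k n‖ₑ * W k n) * (‖entry T n l‖ₑ * W n l) :=
          ENNReal.tsum_le_tsum fun k => key k l
      _ = ∑' n, (∑' k, (‖entry S k n‖ₑ * W k n)) * (‖entry T n l‖ₑ * W n l) := by
          rw [ENNReal.tsum_comm]; simp only [ENNReal.tsum_mul_right]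
      _ ≤ ∑' n, eSchur W (entry S) * (‖entry T n l‖ₑ * W n l) :=
          ENNReal.tsum_le_tsum fun n => by gcongr; exact col_le_eSchur _ _ _
      _ ≤ _ := by rw [ENNReal.tsum_mul_left]; gcongr; exact col_le_eSchur _ _ _

lemma eSchur_entry_pow_le {W : ι → ι → ℝ≥0∞} (hW₁ : ∀ k, W k k ≤ 1)
    (hW : ∀ k n l, W k l ≤ W k n * W n l) (T : EllTwo ι H →L[ℂ] EllTwo ι H) (n : ℕ) :
    eSchur W (entry (T ^ n)) ≤ eSchur W (entry T) ^ n := by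
  induction n with
  | zero => simpa using eSchur_entry_one_le hW₁
  | succ n ih =>
    rw [pow_succ, pow_succ]
    exact (eSchur_entry_mul_le hW _ _).trans (by gcongr)

lemma eSchur_entry_adjoint_le [CompleteSpace H] {W : ι → ι → ℝ≥0∞}
    (hW : ∀ k l, W k l = W l k) (T : EllTwo ι H →L[ℂ] EllTwo ι H) :
    eSchur W (entry (ContinuousLinearMap.adjoint T)) ≤ eSchur W (entry T) := by
  have key : ∀ k l, ‖entry (ContinuousLinearMap.adjoint T) k l‖ₑ * W k l
      = ‖entry T l k‖ₑ * W l k := fun k l => by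
    rw [entry_adjoint, hW k l, LinearIsometryEquiv.enorm_map]
  simp only [eSchur_le_iff, key]
  exact ⟨fun k => col_le_eSchur _ _ _, fun l => row_le_eSchur _ _ _⟩

lemma eSchur_entry_le_of_tendsto {W : ι → ι → ℝ≥0∞} (hW : ∀ k l, W k l ≠ ⊤)
    {T : ℕ → EllTwo ι H →L[ℂ] EllTwo ι H} {S : EllTwo ι H →L[ℂ] EllTwo ι H}
    (hT : Tendsto T atTop (nhds S)) {c : ℝ≥0∞} (h : ∀ n, eSchur W (entry (T n)) ≤ c) :
    eSchur W (entry S) ≤ c := by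
  have key : ∀ k l, Tendsto (fun n => ‖entry (T n) k l‖ₑ * W k l) atTop
      (nhds (‖entry S k l‖ₑ * W k l)) := fun k l => by
    refine ENNReal.Tendsto.mul_const ?_ (Or.inr (hW k l))
    refine (continuous_enorm.tendsto _).comp ?_
    refine tendsto_iff_norm_sub_tendsto_zero.2 (squeeze_zero (fun _ => norm_nonneg _)
      (fun n => ?_) ((tendsto_iff_norm_sub_tendsto_zero
        (E := EllTwo ι H →L[ℂ] EllTwo ι H)).1 hT))
    rw [← entry_sub]
    exact norm_entry_le _ _ _
  rw [eSchur_le_iff]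
  refine ⟨fun k => ?_, fun l => ?_⟩
  · refine ENNReal.summable.tsum_le_of_sum_le fun s => ?_
    exact le_of_tendsto' (tendsto_finsetSum s fun l _ => key k l) fun n =>
      (ENNReal.sum_le_tsum s).trans ((row_le_eSchur W _ k).trans (h n))
  · refine ENNReal.summable.tsum_le_of_sum_le fun s => ?_
    exact le_of_tendsto' (tendsto_finsetSum s fun k _ => key k l) fun n =>
      (ENNReal.sum_le_tsum s).trans ((col_le_eSchur W _ l).trans (h n))

lemma ENNReal.two_mul_mul_le_sq_add_sq (x y : ℝ≥0∞) : 2 * (x * y) ≤ x ^ 2 + y ^ 2 := by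
  induction x with
  | top => simp
  | coe x =>
    induction y with
    | top => simp
    | coe y =>
      norm_cast
      rw [← mul_assoc]
      exact two_mul_le_add_sq x y

lemma ENNReal.sq_tsum_mul_le (a x : ι → ℝ≥0∞) :
    (∑' i, a i * x i) ^ 2 ≤ (∑' i, a i) * ∑' i, a i * x i ^ 2 := by
  have h : 2 * (∑' i, a i * x i) ^ 2 ≤ 2 * ((∑' i, a i) * ∑' i, a i * x i ^ 2) := by
    calc 2 * (∑' i, a i * x i) ^ 2
        = ∑' i, ∑' j, a i * a j * (2 * (x i * x j)) := by
          rw [sq, ← ENNReal.tsum_mul_right, ← ENNReal.tsum_mul_left]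
          refine tsum_congr fun i => ?_
          rw [← ENNReal.tsum_mul_left, ← ENNReal.tsum_mul_left]
          exact tsum_congr fun j => by ring
      _ ≤ ∑' i, ∑' j, (a j * (a i * x i ^ 2) + a i * (a j * x j ^ 2)) := by
          refine ENNReal.tsum_le_tsum fun i => ENNReal.tsum_le_tsum fun j => ?_
          calc _ ≤ a i * a j * (x i ^ 2 + x j ^ 2) := by
                gcongr; exact ENNReal.two_mul_mul_le_sq_add_sq _ _
            _ = _ := by ring
      _ = _ := by
          simp only [ENNReal.tsum_add, ENNReal.tsum_mul_left, ENNReal.tsum_mul_right]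
          rw [two_mul]
  exact (ENNReal.mul_le_mul_iff_right (by norm_num) (by norm_num)).1 h

/-- Schur's test. -/
lemma enorm_le_eSchur_one (T : EllTwo ι H →L[ℂ] EllTwo ι H) :
    ‖T‖ₑ ≤ eSchur (fun _ _ => 1) (entry T) := by
  set M := eSchur (fun _ _ => 1) (entry T) with hM
  have hrow : ∀ k, ∑' l, ‖entry T k l‖ₑ ≤ M := by
    simpa using row_le_eSchur (fun _ _ => 1) (entry T)
  have hcol : ∀ l, ∑' k, ‖entry T k l‖ₑ ≤ M := by
    simpa using col_le_eSchur (fun _ _ => 1) (entry T)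
  refine ContinuousLinearMap.opENorm_le_bound _ fun f => ?_
  rw [← ENNReal.pow_le_pow_left_iff two_ne_zero, EllTwo.enorm_sq_eq_tsum, mul_pow,
    EllTwo.enorm_sq_eq_tsum f]
  calc ∑' k, ‖T f k‖ₑ ^ 2 ≤ ∑' k, M * ∑' l, ‖entry T k l‖ₑ * ‖f l‖ₑ ^ 2 := by
        refine ENNReal.tsum_le_tsum fun k => ?_
        calc ‖T f k‖ₑ ^ 2 ≤ (∑' l, ‖entry T k l‖ₑ * ‖f l‖ₑ) ^ 2 := by
              gcongr
              rw [← (hasSum_entry T f k).tsum_eq]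
              exact enorm_tsum_le_tsum_enorm.trans
                (ENNReal.tsum_le_tsum fun l => ContinuousLinearMap.le_opENorm _ _)
          _ ≤ _ := (ENNReal.sq_tsum_mul_le _ _).trans (by gcongr; exact hrow k)
    _ = M * ∑' l, (∑' k, ‖entry T k l‖ₑ) * ‖f l‖ₑ ^ 2 := by
        rw [ENNReal.tsum_mul_left, ENNReal.tsum_comm]
        simp only [ENNReal.tsum_mul_right]
    _ ≤ M * ∑' l, M * ‖f l‖ₑ ^ 2 := by
        gcongr with l
        exact hcol l
    _ = _ := by rw [ENNReal.tsum_mul_left, sq, mul_assoc]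

end Schur
/-! ### Weights -/

section Weights

lemma ConcaveOn.le_of_nonneg_Ici {ρ : ℝ → ℝ} (hρ : ConcaveOn ℝ (Ici 0) ρ)
    (h0 : ∀ t ∈ Ici (0 : ℝ), 0 ≤ ρ t) {a b : ℝ} (ha : 0 ≤ a) (hab : a ≤ b) : ρ a ≤ ρ b := by
  have key : ∀ t : ℝ, 0 < t → t ≤ 1 → (1 - t) * ρ a ≤ ρ b := fun t ht ht1 => by
    have hz : 0 ≤ a + (b - a) / t := add_nonneg ha (div_nonneg (sub_nonneg.2 hab) ht.le)
    have h := hρ.2 (mem_Ici.2 ha) (mem_Ici.2 hz) (sub_nonneg.2 ht1) ht.le (by ring)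
    have e : (1 - t) • a + t • (a + (b - a) / t) = b := by
      simp only [smul_eq_mul]
      field_simp
      ring
    rw [e] at h
    have := mul_nonneg ht.le (h0 _ hz)
    simp only [smul_eq_mul] at h
    linarith
  have hlim : Tendsto (fun t : ℝ => (1 - t) * ρ a) (nhdsWithin 0 (Ioi 0)) (nhds ((1 - 0) * ρ a)) :=
    (Continuous.tendsto (by fun_prop) 0).mono_left nhdsWithin_le_nhds
  have hev : ∀ᶠ t : ℝ in nhdsWithin 0 (Ioi 0), (1 - t) * ρ a ≤ ρ b := by
    filter_upwards [Ioc_mem_nhdsGT (zero_lt_one' ℝ)] with t ht using key t ht.1 ht.2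
  simpa using le_of_tendsto hlim hev

lemma ConcaveOn.add_shift_le {ρ : ℝ → ℝ} (hρ : ConcaveOn ℝ (Ici 0) ρ) {s t T : ℝ}
    (hs : 0 ≤ s) (hst : s ≤ t) (hT : 0 ≤ T) : ρ (t + T) + ρ s ≤ ρ t + ρ (s + T) := by
  rcases hst.eq_or_lt with rfl | hlt
  · linarith
  have hD : 0 < t - s + T := by linarith
  have hz : t + T ∈ Ici (0 : ℝ) := mem_Ici.2 (by linarith)
  have ha : 0 ≤ T / (t - s + T) := by positivity
  have hb : 0 ≤ (t - s) / (t - s + T) := div_nonneg (by linarith) hD.le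
  have hab : T / (t - s + T) + (t - s) / (t - s + T) = 1 := by field_simp; ring
  have h1 := hρ.2 (mem_Ici.2 hs) hz ha hb hab
  have h2 := hρ.2 (mem_Ici.2 hs) hz hb ha (by rw [add_comm, hab])
  have e1 : (T / (t - s + T)) • s + ((t - s) / (t - s + T)) • (t + T) = t := by
    simp only [smul_eq_mul]; field_simp; ring
  have e2 : ((t - s) / (t - s + T)) • s + (T / (t - s + T)) • (t + T) = s + T := by
    simp only [smul_eq_mul]; field_simp; ring
  rw [e1] at h1
  rw [e2] at h2
  simp only [smul_eq_mul] at h1 h2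
  calc ρ (t + T) + ρ s = (T / (t - s + T) + (t - s) / (t - s + T)) * (ρ s + ρ (t + T)) := by
        rw [hab]; ring
    _ ≤ _ := by linarith

lemma ConcaveOn.shift_sub_le {ρ : ℝ → ℝ} (hρ : ConcaveOn ℝ (Ici 0) ρ) (h0 : ρ 0 = 0) {t T : ℝ}
    (ht : 0 ≤ t) (hT : 0 < T) : ρ (T + t) - ρ T ≤ t * (ρ T / T) := by
  have hz : T + t ∈ Ici (0 : ℝ) := mem_Ici.2 (by linarith)
  have hD : 0 < T + t := by linarith
  have ha : 0 ≤ T / (T + t) := by positivity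
  have hb : 0 ≤ t / (T + t) := by positivity
  have h := hρ.2 hz (mem_Ici.2 le_rfl) ha hb (by field_simp)
  have e : (T / (T + t)) • (T + t) + (t / (T + t)) • (0 : ℝ) = T := by
    simp only [smul_eq_mul]; field_simp; ring
  rw [e] at h
  simp only [smul_eq_mul, h0, mul_zero, add_zero] at h
  have h' : T * ρ (T + t) ≤ (T + t) * ρ T := by
    have := mul_le_mul_of_nonneg_left h hD.le
    calc T * ρ (T + t) = (T + t) * (T / (T + t) * ρ (T + t)) := by field_simp
      _ ≤ _ := this
  rw [← sub_nonneg]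
  have : t * (ρ T / T) - (ρ (T + t) - ρ T) = ((T + t) * ρ T - T * ρ (T + t)) / T := by
    field_simp; ring
  rw [this]
  exact div_nonneg (by linarith) hT.le

/-- A weight `ν` is flattenable if it is dominated by multiples of submultiplicative weights
which are arbitrarily close to `1`, up to a small multiple of `ν`. -/
def Flattenable {d : ℕ} (ν : Euc d → ℝ) : Prop :=
  ∀ η : ℝ, 0 < η → ∃ (w : Euc d → ℝ) (c : ℝ), (∀ x, 0 ≤ w x) ∧ 0 ≤ c ∧ w 0 ≤ 1 ∧
    (∀ x y, w (x + y) ≤ w x * w y) ∧ (∀ x, ν x ≤ c * w x) ∧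
    ∀ x, w x ≤ (1 + η) + η * ν x

lemma flattenable_of_concave {d : ℕ} {ν : Euc d → ℝ} {ρ : ℝ → ℝ} {nrm : Euc d → ℝ}
    (hn : IsNormOn nrm) (hρ : ConcaveOn ℝ (Ici 0) ρ) (h0 : ρ 0 = 0)
    (hpos : ∀ t ∈ Ici (0 : ℝ), 0 ≤ ρ t) (hν : ∀ x, ν x = Real.exp (ρ (nrm x)))
    (hunb : ∀ M, ∃ R, 0 ≤ R ∧ M ≤ ρ R) (hlin : ∀ ε > 0, ∃ T, 0 < T ∧ ρ T / T ≤ ε) :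
    Flattenable ν := by
  intro η hη
  obtain ⟨n0, n1, -, n3⟩ := hn
  obtain ⟨R, hR0, hR⟩ := hunb (Real.log ((1 + η) / η))
  have hl : 0 < Real.log (1 + η) := Real.log_pos (by linarith)
  obtain ⟨T, hT, hTε⟩ := hlin (Real.log (1 + η) / (R + 1)) (by positivity)
  have hRT : ρ (T + R) - ρ T ≤ Real.log (1 + η) := by
    refine (hρ.shift_sub_le h0 hR0 hT).trans ?_
    calc R * (ρ T / T) ≤ (R + 1) * (Real.log (1 + η) / (R + 1)) := by
          have : 0 ≤ ρ T / T := div_nonneg (hpos _ hT.le) hT.le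
          gcongr
          linarith
      _ = _ := by field_simp
  have hmono : ∀ {a b : ℝ}, 0 ≤ a → a ≤ b → ρ a ≤ ρ b := hρ.le_of_nonneg_Ici hpos
  refine ⟨fun x => Real.exp (ρ (T + nrm x) - ρ T), Real.exp (ρ T), fun x => (Real.exp_pos _).le,
    (Real.exp_pos _).le, ?_, fun x y => ?_, fun x => ?_, fun x => ?_⟩
  · simp [(n1 0).2 rfl]
  · rw [← Real.exp_add, Real.exp_le_exp]
    have h1 := hρ.add_shift_le (s := T) (t := T + nrm x) (T := nrm y) hT.le
      (by linarith [n0 x]) (n0 y)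
    have h2 := hmono (a := T + nrm (x + y)) (b := T + nrm x + nrm y)
      (by linarith [n0 (x + y)]) (by linarith [n3 x y])
    linarith
  · rw [← Real.exp_add, hν, Real.exp_le_exp]
    have := hmono (n0 x) (by linarith : nrm x ≤ T + nrm x)
    linarith
  · rcases le_total (nrm x) R with hx | hx
    · have h1 := hmono (a := T + nrm x) (b := T + R) (by linarith [n0 x]) (by linarith)
      have h2 : Real.exp (ρ (T + nrm x) - ρ T) ≤ 1 + η := by
        rw [← Real.le_log_iff_exp_le (by linarith)]
        linarith
      have : 0 ≤ η * ν x := by rw [hν]; positivity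
      linarith
    · have h1 := hρ.add_shift_le hR0 hx hT.le
      have h2 : Real.log ((1 + η) / η) = Real.log (1 + η) - Real.log η :=
        Real.log_div (by linarith) hη.ne'
      have h3 : Real.exp (ρ (T + nrm x) - ρ T) ≤ η * ν x := by
        rw [hν, ← Real.exp_log hη, ← Real.exp_add, Real.exp_le_exp]
        rw [add_comm (nrm x), add_comm R] at h1
        linarith
      linarith

lemma Admissible.flattenable {d : ℕ} {ν : Euc d → ℝ} (hν : Admissible ν) {δ C₀ : ℝ}
    (hδ : 0 < δ) (hC₀ : 0 < C₀) (hgrowth : ∀ x : Euc d, C₀ * (1 + ‖x‖) ^ δ ≤ ν x) :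
    Flattenable ν := by
  obtain ⟨⟨ρ, nrm, hn, -, hρ, h0, hpos, hνρ⟩, hgrs⟩ := hν
  rcases subsingleton_or_nontrivial (Euc d) with hd | hd
  · have h1 : ∀ x, ν x = 1 := fun x => by
      rw [Subsingleton.elim x 0, hνρ, (hn.2.1 0).2 rfl, h0, Real.exp_zero]
    intro η hη
    refine ⟨fun _ => 1, 1, ?_⟩
    simp [h1]
    linarith
  obtain ⟨z, hz⟩ := exists_ne (0 : Euc d)
  have hc : 0 < nrm z := lt_of_le_of_ne (hn.1 z) fun h => hz ((hn.2.1 z).1 h.symm)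
  have hnz : ∀ n : ℕ, nrm ((n : ℝ) • z) = n * nrm z := fun n => by
    rw [hn.2.2.1, abs_of_nonneg (Nat.cast_nonneg n)]
  refine flattenable_of_concave hn hρ h0 hpos hνρ (fun M => ?_) (fun ε hε => ?_)
  · have hz' : 0 < ‖z‖ := norm_pos_iff.2 hz
    have h1 : Tendsto (fun n : ℕ => C₀ * (1 + (n : ℝ) * ‖z‖) ^ δ) atTop atTop := by
      refine Tendsto.const_mul_atTop hC₀ ((tendsto_rpow_atTop hδ).comp ?_)
      exact tendsto_atTop_add_const_left _ _ (tendsto_natCast_atTop_atTop.atTop_mul_const hz')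
    obtain ⟨n, hn'⟩ := (h1.eventually_ge_atTop (Real.exp M)).exists
    refine ⟨nrm ((n : ℝ) • z), hn.1 _, ?_⟩
    have h2 := hgrowth ((n : ℝ) • z)
    rw [norm_smul, Real.norm_natCast, hνρ] at h2
    exact Real.exp_le_exp.1 (hn'.trans h2)
  · have h1 : Tendsto (fun n : ℕ => ρ (n * nrm z) / n) atTop (nhds 0) := by
      have h := ((Real.continuousAt_log one_ne_zero).tendsto.comp (hgrs z))
      rw [Real.log_one] at h
      refine h.congr fun n => ?_
      simp only [Function.comp, hνρ, hnz]
      rw [Real.log_rpow (Real.exp_pos _), Real.log_exp]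
      ring
    obtain ⟨n, hn1, hn2⟩ := ((h1.eventually (gt_mem_nhds (show 0 < ε * nrm z by positivity))).and
      (eventually_gt_atTop 0)).exists
    have hn3 : (0 : ℝ) < n := Nat.cast_pos.2 hn2
    refine ⟨n * nrm z, by positivity, ?_⟩
    rw [div_lt_iff₀ hn3] at hn1
    rw [div_le_iff₀ (by positivity)]
    linarith

/-- The matrix `(k, l) ↦ ν (k - l)` attached to a weight `ν`. -/
def weightMatrix {d : ℕ} (X : Set (Euc d)) (ν : Euc d → ℝ) (k l : X) : ℝ≥0∞ :=
  ENNReal.ofReal (ν ((k : Euc d) - l))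

lemma RelSep.card_le {d : ℕ} {X : Set (Euc d)} (hX : RelSep X) :
    ∃ K : ℝ, 0 ≤ K ∧ ∀ (R : ℝ), 1 ≤ R → ∀ (k : Euc d) (s : Finset X),
      (∀ l ∈ s, ‖k - l‖ ≤ R) → (s.card : ℝ) ≤ K * R ^ d := by
  classical
  obtain ⟨N, hN⟩ := hX
  refine ⟨N * 4 ^ d, by positivity, fun R hR k s hs => ?_⟩
  let φ : X → (Fin d → ℤ) := fun l j => ⌊(l : Euc d) j⌋
  have h1 : s.card ≤ N * (s.image φ).card := by
    refine Finset.card_le_mul_card_image s N fun z _ => ?_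
    obtain ⟨hf, hle⟩ := hN (WithLp.toLp 2 fun j => (z j : ℝ))
    refine le_trans ?_ hle
    rw [← Set.ncard_coe_finset, ← Set.ncard_image_of_injective _ Subtype.val_injective]
    refine Set.ncard_le_ncard ?_ hf
    rintro _ ⟨l, hl, rfl⟩
    simp only [Finset.coe_filter, mem_ofPred_eq] at hl
    refine ⟨l.2, fun j => ?_⟩
    have hj : ⌊(l : Euc d) j⌋ = z j := congrFun hl.2 j
    simp only [← hj]
    exact ⟨Int.floor_le _, (Int.lt_floor_add_one _).le⟩
  have h2 : s.image φ ⊆ Fintype.piFinset fun j => Finset.Icc ⌊k j - R⌋ ⌊k j + R⌋ := by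
    intro z hz
    obtain ⟨l, hl, rfl⟩ := Finset.mem_image.1 hz
    refine Fintype.mem_piFinset.2 fun j => Finset.mem_Icc.2 ?_
    have h3 : |k j - (l : Euc d) j| ≤ R := by
      have := PiLp.norm_apply_le (k - (l : Euc d)) j
      rw [Real.norm_eq_abs] at this
      exact this.trans (hs l hl)
    rw [abs_le] at h3
    exact ⟨Int.floor_le_floor (by linarith), Int.floor_le_floor (by linarith)⟩
  have h3 : ((s.image φ).card : ℝ) ≤ (4 * R) ^ d := by
    refine (Nat.cast_le.2 (Finset.card_le_card h2)).trans ?_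
    rw [Fintype.card_piFinset, Nat.cast_prod]
    refine (Finset.prod_le_prod (g := fun _ => 4 * R) (fun j _ => Nat.cast_nonneg _)
      fun j _ => ?_).trans (by simp)
    rw [Int.card_Icc]
    have h4 : (⌊k j - R⌋ : ℝ) > k j - R - 1 := Int.sub_one_lt_floor _
    have h5 : (⌊k j + R⌋ : ℝ) ≤ k j + R := Int.floor_le _
    have h6 : ⌊k j - R⌋ ≤ ⌊k j + R⌋ := Int.floor_le_floor (by linarith)
    have h7 : (((⌊k j + R⌋ + 1 - ⌊k j - R⌋).toNat : ℤ) : ℝ) = ⌊k j + R⌋ + 1 - ⌊k j - R⌋ := by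
      rw [Int.toNat_of_nonneg (by omega)]
      push_cast
      ring
    rw [← Int.cast_natCast, h7]
    linarith
  calc (s.card : ℝ) ≤ N * (s.image φ).card := by exact_mod_cast h1
    _ ≤ N * (4 * R) ^ d := by gcongr
    _ = _ := by rw [mul_pow]; ring

variable {d : ℕ} {X : Set (Euc d)} {H : Type*} [NormedAddCommGroup H] [InnerProductSpace ℂ H]

lemma RelSep.eSchur_one_le (hX : RelSep X) {ν : Euc d → ℝ} {δ C₀ : ℝ} (hδ : 0 < δ) (hC₀ : 0 < C₀)
    (hgrowth : ∀ x : Euc d, C₀ * (1 + ‖x‖) ^ δ ≤ ν x) :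
    ∃ K : ℝ, 0 ≤ K ∧ ∀ (R : ℝ), 1 ≤ R → ∀ T : EllTwo X H →L[ℂ] EllTwo X H,
      eSchur (fun _ _ => 1) (entry T) ≤ ENNReal.ofReal (K * R ^ d) * ‖T‖ₑ +
        ENNReal.ofReal (C₀⁻¹ * R ^ (-δ)) * eSchur (weightMatrix X ν) (entry T) := by
  classical
  obtain ⟨K, hK, hcard⟩ := hX.card_le
  refine ⟨K, hK, fun R hR T => ?_⟩
  have hR0 : 0 < R := by linarith
  have far : ∀ x : Euc d, R < ‖x‖ →
      (1 : ℝ≥0∞) ≤ ENNReal.ofReal (C₀⁻¹ * R ^ (-δ)) * ENNReal.ofReal (ν x) := fun x hx => by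
    rw [← ENNReal.ofReal_mul (by positivity), ENNReal.one_le_ofReal]
    have h1 : C₀ * R ^ δ ≤ ν x := le_trans (by gcongr; linarith) (hgrowth x)
    calc (1 : ℝ) = C₀⁻¹ * R ^ (-δ) * (C₀ * R ^ δ) := by
          rw [Real.rpow_neg hR0.le]
          have : 0 < R ^ δ := by positivity
          field_simp
      _ ≤ _ := by gcongr
  have key : ∀ (k : X) (a : X → ℝ≥0∞) (u : X → ℝ≥0∞), (∀ l, a l ≤ ‖T‖ₑ) →
      (∀ l : X, R < ‖(k : Euc d) - l‖ → 1 ≤ ENNReal.ofReal (C₀⁻¹ * R ^ (-δ)) * u l) →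
      ∑' l, a l * u l ≤ eSchur (weightMatrix X ν) (entry T) →
      ∑' l, a l * 1 ≤ ENNReal.ofReal (K * R ^ d) * ‖T‖ₑ +
        ENNReal.ofReal (C₀⁻¹ * R ^ (-δ)) * eSchur (weightMatrix X ν) (entry T) := by
    intro k a u ha hu hsum
    refine ENNReal.summable.tsum_le_of_sum_le fun s => ?_
    rw [← Finset.sum_filter_add_sum_filter_not s (fun l : X => ‖(k : Euc d) - l‖ ≤ R)]
    refine add_le_add ?_ ?_
    · refine (Finset.sum_le_card_nsmul _ _ ‖T‖ₑ fun l _ => by simpa using ha l).trans ?_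
      rw [nsmul_eq_mul]
      gcongr
      rw [← ENNReal.ofReal_natCast]
      exact ENNReal.ofReal_le_ofReal (hcard R hR k _ fun l hl => (Finset.mem_filter.1 hl).2)
    · calc _ ≤ ∑ l ∈ s.filter fun l : X => ¬ ‖(k : Euc d) - l‖ ≤ R,
              ENNReal.ofReal (C₀⁻¹ * R ^ (-δ)) * (a l * u l) := by
            refine Finset.sum_le_sum fun l hl => ?_
            calc a l * 1 ≤ a l * (ENNReal.ofReal (C₀⁻¹ * R ^ (-δ)) * u l) := by
                  gcongr
                  exact hu l (not_le.1 (Finset.mem_filter.1 hl).2)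
              _ = _ := by ring
        _ ≤ ∑' l, ENNReal.ofReal (C₀⁻¹ * R ^ (-δ)) * (a l * u l) := ENNReal.sum_le_tsum _
        _ ≤ _ := by rw [ENNReal.tsum_mul_left]; gcongr
  rw [eSchur_le_iff]
  refine ⟨fun k => ?_, fun l => ?_⟩
  · exact key k _ _ (fun l => enorm_entry_le T k l) (fun l hl => far _ hl)
      (row_le_eSchur (weightMatrix X ν) _ k)
  · exact key l _ _ (fun k => enorm_entry_le T k l) (fun k hk => far _ (by rwa [norm_sub_rev]))
      (col_le_eSchur (weightMatrix X ν) _ l)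

end Weights
/-! ### Growth of the Schur norms of powers -/

section Growth

variable {d : ℕ} {X : Set (Euc d)} {H : Type*} [NormedAddCommGroup H] [InnerProductSpace ℂ H]
  {ν : Euc d → ℝ}

lemma weightMatrix_self_le (h0 : ν 0 ≤ 1) (k : X) : weightMatrix X ν k k ≤ 1 := by
  simpa [weightMatrix] using h0

lemma weightMatrix_mul_le (hν : ∀ x, 0 ≤ ν x) (hmul : ∀ x y, ν (x + y) ≤ ν x * ν y)
    (k n l : X) : weightMatrix X ν k l ≤ weightMatrix X ν k n * weightMatrix X ν n l := by
  unfold weightMatrix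
  rw [← ENNReal.ofReal_mul (hν _)]
  refine ENNReal.ofReal_le_ofReal ?_
  simpa using hmul ((k : Euc d) - n) (n - l)

/-- The Schur norms of the powers of `T` grow at most like `q ^ n`. -/
def SchurGrowth (ν : Euc d → ℝ) (T : EllTwo X H →L[ℂ] EllTwo X H) (q : ℝ) : Prop :=
  ∃ C : ℝ, 0 ≤ C ∧ ∀ n, eSchur (weightMatrix X ν) (entry (T ^ n)) ≤ ENNReal.ofReal (C * q ^ n)

lemma Flattenable.schurGrowth (hν : Flattenable ν) {T : EllTwo X H →L[ℂ] EllTwo X H}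
    (hT : eSchur (weightMatrix X ν) (entry T) ≠ ⊤) {q : ℝ}
    (hq : eSchur (fun _ _ => 1) (entry T) < ENNReal.ofReal q) : SchurGrowth ν T q := by
  obtain ⟨a, ha⟩ : ∃ a : ℝ≥0, (a : ℝ≥0∞) = _ := ⟨_, ENNReal.coe_toNNReal hq.ne_top⟩
  obtain ⟨b, hb⟩ : ∃ b : ℝ≥0, (b : ℝ≥0∞) = _ := ⟨_, ENNReal.coe_toNNReal hT⟩
  have haq : (a : ℝ) < q := by
    rw [← ha] at hq
    exact (ENNReal.lt_ofReal_iff_toReal_lt (by simp)).1 hq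
  have hq0 : 0 ≤ q := a.2.trans haq.le
  have hab : (0 : ℝ) < a + b + 1 := by positivity
  have hη : 0 < (q - a) / (a + b + 1) := div_pos (by linarith) hab
  obtain ⟨w, c, hw0, hc, hw1, hwm, hνw, hwν⟩ := hν _ hη
  set η := (q - a) / (a + b + 1) with hηdef
  have hle : (1 + η) * a + η * b ≤ q := by
    have : η * (a + b + 1) = q - a := by rw [hηdef]; field_simp
    nlinarith
  have h1 : eSchur (weightMatrix X w) (entry T) ≤ ENNReal.ofReal q := by
    have h := eSchur_le_of_weight_le (W := weightMatrix X w) (W₁ := fun _ _ => 1)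
      (W₂ := weightMatrix X ν) (a := ENNReal.ofReal (1 + η)) (b := ENNReal.ofReal η)
      (fun k l => by
        unfold weightMatrix
        rw [mul_one, ← ENNReal.ofReal_mul hη.le]
        exact (ENNReal.ofReal_le_ofReal (hwν _)).trans ENNReal.ofReal_add_le) (entry T)
    refine h.trans ?_
    rw [← ha, ← hb, ← ENNReal.ofReal_coe_nnreal, ← ENNReal.ofReal_coe_nnreal,
      ← ENNReal.ofReal_mul (by positivity), ← ENNReal.ofReal_mul (by positivity),
      ← ENNReal.ofReal_add (by positivity) (by positivity)]
    exact ENNReal.ofReal_le_ofReal hle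
  refine ⟨c, hc, fun n => ?_⟩
  calc _ ≤ ENNReal.ofReal c * eSchur (weightMatrix X w) (entry (T ^ n)) := by
        refine eSchur_le_of_weight_le_mul (fun k l => ?_) _
        unfold weightMatrix
        rw [← ENNReal.ofReal_mul hc]
        exact ENNReal.ofReal_le_ofReal (hνw _)
    _ ≤ ENNReal.ofReal c * ENNReal.ofReal q ^ n := by
        gcongr
        exact (eSchur_entry_pow_le (weightMatrix_self_le hw1) (weightMatrix_mul_le hw0 hwm) T n).trans
          (by gcongr)
    _ = _ := by rw [ENNReal.ofReal_mul hc, ENNReal.ofReal_pow hq0]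

lemma Flattenable.schurGrowth_of_pow (hν : Flattenable ν) (hν0 : ∀ x, 0 ≤ ν x) (h0 : ν 0 ≤ 1)
    (hmul : ∀ x y, ν (x + y) ≤ ν x * ν y) {T : EllTwo X H →L[ℂ] EllTwo X H}
    (hT : eSchur (weightMatrix X ν) (entry T) ≠ ⊤) {q : ℝ} (hq0 : 0 < q) {m : ℕ} (hm : m ≠ 0)
    (hq : eSchur (fun _ _ => 1) (entry (T ^ m)) < ENNReal.ofReal (q ^ m)) :
    SchurGrowth ν T q := by
  have hpow := eSchur_entry_pow_le (weightMatrix_self_le (X := X) h0)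
    (weightMatrix_mul_le hν0 hmul) T
  obtain ⟨C, hC, h⟩ := hν.schurGrowth (ne_top_of_le_ne_top (ENNReal.pow_ne_top hT) (hpow m)) hq
  set b : ℝ := max 1 (eSchur (weightMatrix X ν) (entry T)).toReal with hb
  have hb1 : 1 ≤ b := le_max_left _ _
  have hTb : eSchur (weightMatrix X ν) (entry T) ≤ ENNReal.ofReal b := by
    rw [← ENNReal.ofReal_toReal hT]
    exact ENNReal.ofReal_le_ofReal (le_max_right _ _)
  set e : ℝ := max 1 q⁻¹ with he
  have he1 : 1 ≤ e := le_max_left _ _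
  have heq : 1 ≤ e * q := by
    calc 1 = q⁻¹ * q := by field_simp
      _ ≤ e * q := by gcongr; exact le_max_right _ _
  refine ⟨C * b ^ m * e ^ m, by positivity, fun n => ?_⟩
  have hmod : n % m ≤ m := (Nat.mod_lt n (Nat.pos_of_ne_zero hm)).le
  have hsplit : T ^ n = (T ^ m) ^ (n / m) * T ^ (n % m) := by
    rw [← pow_mul, ← pow_add, Nat.div_add_mod]
  rw [hsplit]
  calc _ ≤ ENNReal.ofReal (C * (q ^ m) ^ (n / m)) * ENNReal.ofReal b ^ (n % m) :=
        (eSchur_entry_mul_le (weightMatrix_mul_le hν0 hmul) _ _).trans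
          (mul_le_mul' (h _) ((hpow _).trans (by gcongr)))
    _ = ENNReal.ofReal (C * (q ^ m) ^ (n / m) * b ^ (n % m)) := by
        rw [← ENNReal.ofReal_pow (by positivity), ← ENNReal.ofReal_mul (by positivity)]
    _ ≤ _ := by
        refine ENNReal.ofReal_le_ofReal ?_
        calc C * (q ^ m) ^ (n / m) * b ^ (n % m)
            ≤ C * (q ^ m) ^ (n / m) * b ^ m * (e * q) ^ (n % m) := by
              have h1 : b ^ (n % m) ≤ b ^ m := pow_le_pow_right₀ hb1 hmod
              have h2 : 1 ≤ (e * q) ^ (n % m) := one_le_pow₀ heq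
              calc _ ≤ C * (q ^ m) ^ (n / m) * b ^ m * 1 := by rw [mul_one]; gcongr
                _ ≤ _ := by gcongr
          _ = C * b ^ m * e ^ (n % m) * q ^ n := by
              conv_rhs => rw [← Nat.div_add_mod n m, pow_add, pow_mul]
              rw [Nat.div_add_mod, mul_pow]
              ring
          _ ≤ _ := by gcongr

lemma schurGrowth_of_norm_pow_le (hX : RelSep X) {δ C₀ : ℝ} (hδ : 0 < δ) (hC₀ : 0 < C₀)
    (hgrowth : ∀ x : Euc d, C₀ * (1 + ‖x‖) ^ δ ≤ ν x)
    (hν : Flattenable ν) (hν0 : ∀ x, 0 ≤ ν x) (h0 : ν 0 ≤ 1)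
    (hmul : ∀ x y, ν (x + y) ≤ ν x * ν y) {T : EllTwo X H →L[ℂ] EllTwo X H}
    (hT : eSchur (weightMatrix X ν) (entry T) ≠ ⊤) {B s q : ℝ} (hs : 0 ≤ s) (hsq : s < q)
    (hB : ∀ n, ‖T ^ n‖ ≤ B * s ^ n) : SchurGrowth ν T q := by
  have hq0 : 0 < q := hs.trans_lt hsq
  have hB0 : 0 ≤ B := by simpa using (norm_nonneg (T ^ 0)).trans (hB 0)
  obtain ⟨K, hK, hdecay⟩ := hX.eSchur_one_le (H := H) hδ hC₀ hgrowth
  obtain ⟨κ, hκq, hκ1⟩ : ∃ κ : ℝ, κ ^ d * s * κ ^ (δ / 2) ≤ q ∧ 1 < κ := by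
    have hc : ContinuousAt (fun κ : ℝ => κ ^ d * s * κ ^ (δ / 2)) 1 := by
      refine ContinuousAt.mul (by fun_prop) ?_
      exact Real.continuousAt_rpow_const _ _ (Or.inl one_ne_zero)
    have h1 : ∀ᶠ κ : ℝ in nhds 1, κ ^ d * s * κ ^ (δ / 2) < q :=
      hc.eventually (gt_mem_nhds (by simpa using hsq))
    obtain ⟨κ, h2, h3⟩ := ((h1.filter_mono nhdsWithin_le_nhds).and
      (self_mem_nhdsWithin : Ioi (1 : ℝ) ∈ nhdsWithin 1 (Ioi 1))).exists
    exact ⟨κ, h2.le, h3⟩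
  have hκ0 : 0 < κ := by linarith
  set μ : ℝ := κ ^ (δ / 2) with hμ
  have hμ1 : 1 < μ := Real.one_lt_rpow hκ1 (by positivity)
  have hμ0 : 0 < μ := by linarith
  have hμδ : ∀ n : ℕ, (κ ^ n) ^ (-δ) = (μ⁻¹ ^ 2) ^ n := fun n => by
    rw [hμ, ← Real.rpow_neg hκ0.le, ← Real.rpow_natCast, ← Real.rpow_natCast, ← Real.rpow_natCast,
      ← Real.rpow_mul hκ0.le, ← Real.rpow_mul hκ0.le, ← Real.rpow_mul hκ0.le]
    congr 1
    push_cast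
    ring
  have step : ∀ p, q ≤ p → SchurGrowth ν T (p * μ) → SchurGrowth ν T p := by
    rintro p hp ⟨C, hC, hCn⟩
    have hp0 : 0 < p := hq0.trans_le hp
    set D : ℝ := K * B + C₀⁻¹ * C with hD
    have hbound : ∀ n : ℕ, eSchur (fun _ _ => 1) (entry (T ^ n))
        ≤ ENNReal.ofReal (D * μ⁻¹ ^ n * p ^ n) := fun n => by
      refine (hdecay (κ ^ n) (one_le_pow₀ hκ1.le) (T ^ n)).trans ?_
      calc _ ≤ ENNReal.ofReal (K * (κ ^ n) ^ d) * ENNReal.ofReal (B * s ^ n) +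
            ENNReal.ofReal (C₀⁻¹ * (κ ^ n) ^ (-δ)) * ENNReal.ofReal (C * (p * μ) ^ n) := by
            gcongr
            · rw [← ofReal_norm]
              exact ENNReal.ofReal_le_ofReal (hB n)
            · exact hCn n
        _ = ENNReal.ofReal (K * B * (κ ^ d * s) ^ n + C₀⁻¹ * C * (μ⁻¹ ^ n * p ^ n)) := by
            rw [← ENNReal.ofReal_mul (by positivity), ← ENNReal.ofReal_mul (by positivity),
              ← ENNReal.ofReal_add (by positivity) (by positivity), hμδ]
            congr 1
            have : (μ⁻¹ ^ 2) ^ n * (p * μ) ^ n = μ⁻¹ ^ n * p ^ n := by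
              rw [← mul_pow, ← mul_pow]
              congr 1
              field_simp
            rw [← this, ← pow_mul, mul_comm n d, pow_mul, mul_pow (κ ^ d) s n]
            ring
        _ ≤ _ := by
            refine ENNReal.ofReal_le_ofReal ?_
            have h1 : (κ ^ d * s) ^ n ≤ μ⁻¹ ^ n * p ^ n := by
              rw [← mul_pow]
              refine pow_le_pow_left₀ (by positivity) ?_ n
              rw [inv_mul_eq_div, le_div_iff₀ hμ0]
              exact hκq.trans hp
            calc _ ≤ K * B * (μ⁻¹ ^ n * p ^ n) + C₀⁻¹ * C * (μ⁻¹ ^ n * p ^ n) := by gcongr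
              _ = _ := by rw [hD]; ring
    have hlim : Tendsto (fun n : ℕ => D * μ⁻¹ ^ n) atTop (nhds (D * 0)) :=
      (tendsto_pow_atTop_nhds_zero_of_lt_one (by positivity) (inv_lt_one_of_one_lt₀ hμ1)).const_mul D
    rw [mul_zero] at hlim
    obtain ⟨m, hm, hm0⟩ := ((hlim.eventually (gt_mem_nhds one_pos)).and
      (eventually_ne_atTop 0)).exists
    refine hν.schurGrowth_of_pow hν0 h0 hmul hT hp0 hm0 ((hbound m).trans_lt ?_)
    rw [ENNReal.ofReal_lt_ofReal_iff (by positivity)]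
    have : 0 < p ^ m := by positivity
    nlinarith
  have descend : ∀ j : ℕ, SchurGrowth ν T (q * μ ^ j) → SchurGrowth ν T q := fun j => by
    induction j with
    | zero => simp
    | succ j ih =>
      intro h
      refine ih (step _ (le_mul_of_one_le_right hq0.le (one_le_pow₀ hμ1.le)) ?_)
      rwa [mul_assoc, ← pow_succ]
  obtain ⟨j, hj⟩ := pow_unbounded_of_one_lt
    ((eSchur (weightMatrix X ν) (entry T)).toReal / q) hμ1
  refine descend j ⟨1, zero_le_one, fun n => ?_⟩
  refine (eSchur_entry_pow_le (weightMatrix_self_le h0) (weightMatrix_mul_le hν0 hmul) T n).trans ?_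
  rw [one_mul, ENNReal.ofReal_pow (by positivity)]
  gcongr
  rw [← ENNReal.ofReal_toReal hT]
  refine ENNReal.ofReal_le_ofReal ?_
  rw [div_lt_iff₀ hq0] at hj
  linarith

lemma exists_norm_pow_le_of_spectralRadius_lt {A : Type*} [NormedRing A] [NormedAlgebra ℂ A]
    [CompleteSpace A] {a : A} {q : ℝ} (h : spectralRadius ℂ a < ENNReal.ofReal q) :
    ∃ B s : ℝ, 0 ≤ s ∧ s < q ∧ ∀ n, ‖a ^ n‖ ≤ B * s ^ n := by
  obtain ⟨s, hs1, hs2⟩ := ENNReal.lt_iff_exists_nnreal_btwn.1 h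
  have hsq : (s : ℝ) < q := (ENNReal.lt_ofReal_iff_toReal_lt (by simp)).1 hs2
  have hs0 : (0 : ℝ) < s := by
    have : (0 : ℝ≥0∞) < s := pos_of_gt hs1
    exact_mod_cast this
  have hev := (spectrum.pow_nnnorm_pow_one_div_tendsto_nhds_spectralRadius a).eventually
    (gt_mem_nhds hs1)
  obtain ⟨N, hN⟩ := eventually_atTop.1 (hev.and (eventually_gt_atTop 0))
  have hlarge : ∀ n, N ≤ n → ‖a ^ n‖ ≤ s ^ n := fun n hn => by
    obtain ⟨h1, h2⟩ := hN n hn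
    have h3 : ((‖a ^ n‖₊ : ℝ≥0∞) ^ (1 / (n : ℝ))) ^ (n : ℝ) ≤ (s : ℝ≥0∞) ^ (n : ℝ) := by
      gcongr
    rw [← ENNReal.rpow_mul, one_div, inv_mul_cancel₀ (by positivity), ENNReal.rpow_one,
      ENNReal.rpow_natCast] at h3
    exact_mod_cast h3
  refine ⟨1 + ∑ i ∈ Finset.range N, ‖a ^ i‖ / s ^ i, s, s.2, hsq, fun n => ?_⟩
  have hsum : 0 ≤ ∑ i ∈ Finset.range N, ‖a ^ i‖ / (s : ℝ) ^ i :=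
    Finset.sum_nonneg fun i _ => by positivity
  have hsn : 0 < (s : ℝ) ^ n := by positivity
  rcases le_or_gt N n with hn | hn
  · exact (hlarge n hn).trans (le_mul_of_one_le_left hsn.le (by linarith))
  · have h1 := Finset.single_le_sum (f := fun i => ‖a ^ i‖ / (s : ℝ) ^ i)
      (fun i _ => by positivity) (Finset.mem_range.2 hn)
    rw [← div_le_iff₀ hsn]
    exact h1.trans (by linarith)

end Growth
/-! ### The Schur class as a set of matrices of bounded operators -/

section Bridge

lemma iSup_tsum_ofReal_ne_top_iff {ι κ : Type*} {f : ι → κ → ℝ} (hf : ∀ i j, 0 ≤ f i j) :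
    ⨆ i, ∑' j, ENNReal.ofReal (f i j) ≠ ⊤ ↔
      (∀ i, Summable (f i)) ∧ BddAbove (range fun i => ∑' j, f i j) := by
  constructor
  · intro h
    have hi : ∀ i, ∑' j, ENNReal.ofReal (f i j) ≠ ⊤ := fun i =>
      ne_top_of_le_ne_top h (le_iSup (fun i => ∑' j, ENNReal.ofReal (f i j)) i)
    have hs : ∀ i, Summable (f i) := fun i => by
      simpa [ENNReal.toReal_ofReal (hf i _)] using ENNReal.summable_toReal (hi i)
    refine ⟨hs, (⨆ i, ∑' j, ENNReal.ofReal (f i j)).toReal, ?_⟩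
    rintro _ ⟨i, rfl⟩
    refine (ENNReal.ofReal_le_iff_le_toReal h).1 ?_
    rw [ENNReal.ofReal_tsum_of_nonneg (hf i) (hs i)]
    exact le_iSup (fun i => ∑' j, ENNReal.ofReal (f i j)) i
  · rintro ⟨hs, b, hb⟩
    refine ne_top_of_le_ne_top (b := ENNReal.ofReal b) ENNReal.ofReal_ne_top (iSup_le fun i => ?_)
    rw [← ENNReal.ofReal_tsum_of_nonneg (hf i) (hs i)]
    exact ENNReal.ofReal_le_ofReal (hb ⟨i, rfl⟩)

lemma toReal_iSup_tsum_ofReal {ι κ : Type*} {f : ι → κ → ℝ} (hf : ∀ i j, 0 ≤ f i j)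
    (h : ⨆ i, ∑' j, ENNReal.ofReal (f i j) ≠ ⊤) :
    (⨆ i, ∑' j, ENNReal.ofReal (f i j)).toReal = ⨆ i, ∑' j, f i j := by
  rw [ENNReal.toReal_iSup fun i =>
    ne_top_of_le_ne_top h (le_iSup (fun i => ∑' j, ENNReal.ofReal (f i j)) i)]
  congr 1 with i
  rw [← ENNReal.ofReal_tsum_of_nonneg (hf i) (((iSup_tsum_ofReal_ne_top_iff hf).1 h).1 i),
    ENNReal.toReal_ofReal (tsum_nonneg (hf i))]

variable {d : ℕ} {X : Set (Euc d)} {H : Type*} [NormedAddCommGroup H] [InnerProductSpace ℂ H]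
  {ν : Euc d → ℝ}

lemma eSchur_weightMatrix_eq (A : X → X → (H →L[ℂ] H)) :
    eSchur (weightMatrix X ν) A =
      max (⨆ k, ∑' l, ENNReal.ofReal (‖A k l‖ * ν ((k : Euc d) - l)))
        (⨆ l, ∑' k, ENNReal.ofReal (‖A k l‖ * ν ((k : Euc d) - l))) := by
  simp only [eSchur, weightMatrix, ENNReal.ofReal_mul (norm_nonneg _), ofReal_norm]

lemma eSchur_weightMatrix_ne_top_iff (hν0 : ∀ x, 0 ≤ ν x) (A : X → X → (H →L[ℂ] H)) :
    eSchur (weightMatrix X ν) A ≠ ⊤ ↔ MemSchur1 ν A := by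
  rw [eSchur_weightMatrix_eq, MemSchur1, ← lt_top_iff_ne_top, max_lt_iff, lt_top_iff_ne_top,
    lt_top_iff_ne_top,
    iSup_tsum_ofReal_ne_top_iff fun k l => mul_nonneg (norm_nonneg (A k l)) (hν0 _),
    iSup_tsum_ofReal_ne_top_iff fun l k => mul_nonneg (norm_nonneg (A k l)) (hν0 _), and_assoc]

lemma schurNorm1_eq_toReal (hν0 : ∀ x, 0 ≤ ν x) {A : X → X → (H →L[ℂ] H)}
    (hA : eSchur (weightMatrix X ν) A ≠ ⊤) :
    schurNorm1 ν A = (eSchur (weightMatrix X ν) A).toReal := by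
  rw [eSchur_weightMatrix_eq] at hA ⊢
  have h := max_lt_iff.1 (lt_top_iff_ne_top.2 hA)
  rw [ENNReal.toReal_max h.1.ne h.2.ne,
    toReal_iSup_tsum_ofReal (fun k l => mul_nonneg (norm_nonneg (A k l)) (hν0 _)) h.1.ne,
    toReal_iSup_tsum_ofReal (fun l k => mul_nonneg (norm_nonneg (A k l)) (hν0 _)) h.2.ne]
  rfl

lemma entry_eq_of_apply_eq_tsum {ι : Type*} {A : ι → ι → (H →L[ℂ] H)}
    {T : EllTwo ι H →L[ℂ] EllTwo ι H} (hT : ∀ f k, T f k = ∑' l, A k l (f l)) : entry T = A := by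
  ext k l f
  rw [entry_apply, hT, tsum_eq_single l fun m hm => by rw [deltaSeq_apply_ne hm, map_zero],
    deltaSeq_apply_self]

lemma matMul_entry {ι : Type*} [CompleteSpace H] {S : EllTwo ι H →L[ℂ] EllTwo ι H}
    (hS : eSchur (fun _ _ => 1) (entry S) ≠ ⊤) (T : EllTwo ι H →L[ℂ] EllTwo ι H) :
    matMul (entry S) (entry T) = entry (S * T) := by
  ext k l f
  have hk : ∑' n, ‖entry S k n‖ₑ ≠ ⊤ :=
    ne_top_of_le_ne_top hS (by simpa using row_le_eSchur (fun _ _ => 1) (entry S) k)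
  have hsk : Summable fun n => ‖entry S k n‖ := by simpa using ENNReal.summable_toReal hk
  have hs : Summable fun n => (entry S k n) ∘L (entry T n l) :=
    Summable.of_norm_bounded (hsk.mul_right ‖T‖) fun n =>
      (ContinuousLinearMap.opNorm_comp_le _ _).trans
        (mul_le_mul_of_nonneg_left (norm_entry_le T n l) (norm_nonneg _))
  have h1 := hs.hasSum.mapL (ContinuousLinearMap.apply ℂ H f)
  exact h1.unique (hasSum_entry S (T (deltaSeq 2 l f)) k)

end Bridge

section Weight

variable {d : ℕ} {X : Set (Euc d)} {H : Type*} [NormedAddCommGroup H] [InnerProductSpace ℂ H]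
  {ν : Euc d → ℝ}

lemma Admissible.one_le (hν : Admissible ν) (x : Euc d) : 1 ≤ ν x := by
  obtain ⟨⟨ρ, nrm, hn, -, -, -, hpos, h⟩, -⟩ := hν
  rw [h]
  exact Real.one_le_exp (hpos _ (hn.1 x))

lemma Admissible.nonneg (hν : Admissible ν) (x : Euc d) : 0 ≤ ν x :=
  zero_le_one.trans (hν.one_le x)

lemma Admissible.map_zero (hν : Admissible ν) : ν 0 = 1 := by
  obtain ⟨⟨ρ, nrm, hn, -, -, h0, -, h⟩, -⟩ := hν
  rw [h, (hn.2.1 0).2 rfl, h0, Real.exp_zero]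

lemma Admissible.map_neg (hν : Admissible ν) (x : Euc d) : ν (-x) = ν x := by
  obtain ⟨⟨ρ, nrm, hn, -, -, -, -, h⟩, -⟩ := hν
  have := hn.2.2.1 (-1) x
  rw [h, h, ← neg_one_smul ℝ x, this]
  simp

lemma Admissible.map_add_le (hν : Admissible ν) (x y : Euc d) : ν (x + y) ≤ ν x * ν y := by
  obtain ⟨⟨ρ, nrm, ⟨n0, -, -, n3⟩, -, hρ, h0, hpos, h⟩, -⟩ := hν
  rw [h, h, h, ← Real.exp_add]
  refine Real.exp_le_exp.2 ((hρ.le_of_nonneg_Ici hpos (n0 _) (n3 x y)).trans ?_)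
  simpa [h0] using hρ.add_shift_le le_rfl (n0 x) (n0 y)

lemma Admissible.weightMatrix_comm (hν : Admissible ν) (k l : X) :
    weightMatrix X ν k l = weightMatrix X ν l k := by
  rw [weightMatrix, weightMatrix, ← hν.map_neg, neg_sub]

lemma Admissible.eSchur_one_le (hν : Admissible ν) (A : X → X → (H →L[ℂ] H)) :
    eSchur (fun _ _ => 1) A ≤ eSchur (weightMatrix X ν) A := by
  simpa using eSchur_le_of_weight_le_mul (W₁ := weightMatrix X ν) (a := 1) (fun k l => by
    rw [one_mul, weightMatrix, ← ENNReal.ofReal_one]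
    exact ENNReal.ofReal_le_ofReal (hν.one_le _)) A

lemma Admissible.enorm_le_eSchur (hν : Admissible ν) (T : EllTwo X H →L[ℂ] EllTwo X H) :
    ‖T‖ₑ ≤ eSchur (weightMatrix X ν) (entry T) :=
  (enorm_le_eSchur_one T).trans (hν.eSchur_one_le _)

lemma Admissible.eSchur_mul_le (hν : Admissible ν) (S T : EllTwo X H →L[ℂ] EllTwo X H) :
    eSchur (weightMatrix X ν) (entry (S * T)) ≤
      eSchur (weightMatrix X ν) (entry S) * eSchur (weightMatrix X ν) (entry T) :=
  eSchur_entry_mul_le (weightMatrix_mul_le hν.nonneg hν.map_add_le) S T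

lemma Admissible.eSchur_pow_ne_top (hν : Admissible ν) {T : EllTwo X H →L[ℂ] EllTwo X H}
    (hT : eSchur (weightMatrix X ν) (entry T) ≠ ⊤) (n : ℕ) :
    eSchur (weightMatrix X ν) (entry (T ^ n)) ≠ ⊤ :=
  ne_top_of_le_ne_top (ENNReal.pow_ne_top hT) (eSchur_entry_pow_le
    (weightMatrix_self_le hν.map_zero.le) (weightMatrix_mul_le hν.nonneg hν.map_add_le) T n)

lemma Admissible.matPow_entry [CompleteSpace H] (hν : Admissible ν)
    {T : EllTwo X H →L[ℂ] EllTwo X H} (hT : eSchur (weightMatrix X ν) (entry T) ≠ ⊤) (n : ℕ) :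
    matPow (entry T) n = entry (T ^ (n + 1)) := by
  induction n with
  | zero => rw [zero_add, pow_one]; rfl
  | succ n ih =>
    rw [matPow, ih, pow_succ _ (n + 1)]
    exact matMul_entry
      (ne_top_of_le_ne_top (hν.eSchur_pow_ne_top hT _) (hν.eSchur_one_le _)) T

/-- The Schur norms of the powers of `T` do not grow faster than the spectral radius permits. -/
lemma Admissible.schurGrowth [CompleteSpace H] (hX : RelSep X) (hν : Admissible ν) {δ C₀ : ℝ}
    (hδ : 0 < δ) (hC₀ : 0 < C₀) (hgrowth : ∀ x : Euc d, C₀ * (1 + ‖x‖) ^ δ ≤ ν x)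
    {T : EllTwo X H →L[ℂ] EllTwo X H} (hT : eSchur (weightMatrix X ν) (entry T) ≠ ⊤) {q : ℝ}
    (hq : spectralRadius ℂ T < ENNReal.ofReal q) : SchurGrowth ν T q := by
  obtain ⟨B, s, hs, hsq, hB⟩ := exists_norm_pow_le_of_spectralRadius_lt hq
  exact schurGrowth_of_norm_pow_le hX hδ hC₀ hgrowth (hν.flattenable hδ hC₀ hgrowth) hν.nonneg
    hν.map_zero.le hν.map_add_le hT hs hsq hB

end Weight

section InverseClosed

lemma exists_spectralRadius_one_sub_smul_lt_one {A : Type*} [CStarAlgebra A] {a b : A}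
    (hab : a * b = 1) (hba : b * a = 1) :
    ∃ c : ℝ, 0 < c ∧ spectralRadius ℂ (1 - (c : ℂ) • (star a * a)) < 1 := by
  set P := star a * a with hP
  have hsa : IsSelfAdjoint P := .star_mul_self a
  have hunit : IsUnit P := by
    have ha : IsUnit a := ⟨⟨a, b, hab, hba⟩, rfl⟩
    exact ha.star.mul ha
  have hc0 : 0 < (‖P‖ + 1)⁻¹ := by positivity
  refine ⟨(‖P‖ + 1)⁻¹, hc0, ?_⟩
  set c : ℝ := (‖P‖ + 1)⁻¹ with hc
  rcases subsingleton_or_nontrivial A with hA | hA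
  · rw [spectrum.SpectralRadius.of_subsingleton]
    exact one_pos
  refine spectrum.spectralRadius_lt_of_forall_lt (r := 1) _ fun z hz => ?_
  have hcu : (c : ℂ) ≠ 0 := by exact_mod_cast hc0.ne'
  have h1 : (1 : A) - (c : ℂ) • P = algebraMap ℂ A 1 - (Units.mk0 (c : ℂ) hcu) • P := by
    rw [map_one]; rfl
  rw [h1, ← spectrum.singleton_sub_eq, spectrum.unit_smul_eq_smul, Set.singleton_sub] at hz
  obtain ⟨w, ⟨p, hp, rfl⟩, rfl⟩ := hz
  have hpre : p = p.re := hsa.mem_spectrum_eq_re hp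
  have hp' : p.re ∈ spectrum ℝ P := by
    rw [← spectrum.algebraMap_mem_iff ℂ]
    rwa [hpre] at hp
  have hp0 : 0 ≤ p.re := spectrum_star_mul_self_nonneg _ hp'
  have hpne : p.re ≠ 0 := fun h => by
    rw [h] at hp'
    exact spectrum.zero_notMem ℝ hunit hp'
  have hple : p.re ≤ ‖P‖ := (Complex.re_le_norm p).trans (spectrum.norm_le_norm_of_mem hp)
  have hcp : c * p.re < 1 := by
    rw [hc, inv_mul_lt_iff₀ (by positivity)]
    linarith
  have hcp0 : 0 < c * p.re := mul_pos hc0 (lt_of_le_of_ne hp0 hpne.symm)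
  rw [← NNReal.coe_lt_coe, coe_nnnorm]
  have hz : (1 : ℂ) - (c : ℂ) * p = ((1 - c * p.re : ℝ) : ℂ) := by
    rw [hpre]
    push_cast
    simp
  change ‖(1 : ℂ) - (c : ℂ) * p‖ < 1
  rw [hz, Complex.norm_real, Real.norm_eq_abs, abs_lt]
  constructor <;> linarith

variable {d : ℕ} {X : Set (Euc d)} {H : Type*} [NormedAddCommGroup H] [InnerProductSpace ℂ H]
  [CompleteSpace H] {ν : Euc d → ℝ}

lemma Admissible.eSchur_inverse_ne_top (hX : RelSep X) (hν : Admissible ν) {δ C₀ : ℝ}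
    (hδ : 0 < δ) (hC₀ : 0 < C₀) (hgrowth : ∀ x : Euc d, C₀ * (1 + ‖x‖) ^ δ ≤ ν x)
    {S T : EllTwo X H →L[ℂ] EllTwo X H} (hT : eSchur (weightMatrix X ν) (entry T) ≠ ⊤)
    (hST : S * T = 1) (hTS : T * S = 1) : eSchur (weightMatrix X ν) (entry S) ≠ ⊤ := by
  have hTadj : eSchur (weightMatrix X ν) (entry (star T)) ≠ ⊤ :=
    ne_top_of_le_ne_top hT (eSchur_entry_adjoint_le hν.weightMatrix_comm T)
  obtain ⟨c, hc, hrad⟩ := exists_spectralRadius_one_sub_smul_lt_one hTS hST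
  set P := star T * T with hP
  set Q := 1 - (c : ℂ) • P with hQ
  have hPfin : eSchur (weightMatrix X ν) (entry P) ≠ ⊤ :=
    ne_top_of_le_ne_top (ENNReal.mul_ne_top hTadj hT) (hν.eSchur_mul_le _ _)
  have hQfin : eSchur (weightMatrix X ν) (entry Q) ≠ ⊤ := by
    have hQ' : Q = 1 + (-(c : ℂ)) • P := by rw [hQ, neg_smul, sub_eq_add_neg]
    rw [hQ']
    refine ne_top_of_le_ne_top (ENNReal.add_ne_top.2 ⟨?_, ?_⟩) (eSchur_entry_add_le _ _ _)
    · exact ne_top_of_le_ne_top ENNReal.one_ne_top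
        (eSchur_entry_one_le (weightMatrix_self_le hν.map_zero.le))
    · exact ne_top_of_le_ne_top (ENNReal.mul_ne_top enorm_ne_top hPfin) (eSchur_entry_smul _ _ _)
  obtain ⟨q, hq1, hq2⟩ := ENNReal.lt_iff_exists_nnreal_btwn.1 hrad
  have hq2' : (q : ℝ) < 1 := by exact_mod_cast hq2
  rw [← ENNReal.ofReal_coe_nnreal] at hq1
  obtain ⟨C, hC, hgr⟩ := hν.schurGrowth hX hδ hC₀ hgrowth hQfin hq1
  have hQn : ∀ n, ‖Q ^ n‖ ≤ C * (q : ℝ) ^ n := fun n => by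
    have h := (hν.enorm_le_eSchur (Q ^ n)).trans (hgr n)
    rwa [← ofReal_norm, ENNReal.ofReal_le_ofReal_iff (by positivity)] at h
  have hQ0 : Tendsto (fun n => Q ^ n) atTop (nhds 0) := by
    refine squeeze_zero_norm (E := EllTwo X H →L[ℂ] EllTwo X H) hQn ?_
    simpa using (tendsto_pow_atTop_nhds_zero_of_lt_one q.2 hq2').const_mul C
  have hPS : P * (S * star S) = 1 := by
    calc P * (S * star S) = star T * (T * S) * star S := by rw [hP]; simp only [mul_assoc]
      _ = star (S * T) := by rw [hTS, mul_one, star_mul]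
      _ = 1 := by rw [hST, star_one]
  have hgeom : ∀ n, (c : ℂ) • ∑ i ∈ Finset.range n, Q ^ i = (1 - Q ^ n) * (S * star S) :=
    fun n => by
      have h1 : (∑ i ∈ Finset.range n, Q ^ i) * ((c : ℂ) • P) = 1 - Q ^ n := by
        rw [← geom_sum_mul_neg, hQ, sub_sub_cancel]
      rw [← h1, mul_assoc, smul_mul_assoc, hPS, mul_smul_comm, mul_one]
  have hlim : Tendsto (fun n => (c : ℂ) • ∑ i ∈ Finset.range n, Q ^ i) atTop
      (nhds (S * star S)) := by
    simp only [hgeom]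
    simpa using (hQ0.const_sub 1).mul_const (S * star S)
  have hSS : eSchur (weightMatrix X ν) (entry (S * star S)) ≠ ⊤ := by
    refine ne_top_of_le_ne_top (b := ‖(c : ℂ)‖ₑ * ENNReal.ofReal (C * (1 - (q : ℝ))⁻¹))
      (ENNReal.mul_ne_top enorm_ne_top ENNReal.ofReal_ne_top)
      (eSchur_entry_le_of_tendsto (fun _ _ => ENNReal.ofReal_ne_top) hlim fun n => ?_)
    refine (eSchur_entry_smul _ _ _).trans ?_
    gcongr
    refine (eSchur_entry_sum_le _ _ n).trans ((Finset.sum_le_sum fun i _ => hgr i).trans ?_)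
    rw [← ENNReal.ofReal_sum_of_nonneg fun i _ => by positivity, ← Finset.mul_sum]
    refine ENNReal.ofReal_le_ofReal (mul_le_mul_of_nonneg_left ?_ hC)
    exact sum_le_hasSum _ (fun i _ => by positivity)
      (hasSum_geometric_of_lt_one q.coe_nonneg hq2')
  have hS : S = S * star S * star T := by
    rw [mul_assoc, ← star_mul, hTS, star_one, mul_one]
  rw [hS]
  exact ne_top_of_le_ne_top (ENNReal.mul_ne_top hSS hTadj) (hν.eSchur_mul_le _ _)

lemma Admissible.tendsto_eSchur_pow (hX : RelSep X) (hν : Admissible ν) {δ C₀ : ℝ}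
    (hδ : 0 < δ) (hC₀ : 0 < C₀) (hgrowth : ∀ x : Euc d, C₀ * (1 + ‖x‖) ^ δ ≤ ν x)
    {T : EllTwo X H →L[ℂ] EllTwo X H} (hT : eSchur (weightMatrix X ν) (entry T) ≠ ⊤) :
    Tendsto (fun n : ℕ => (eSchur (weightMatrix X ν) (entry (T ^ (n + 1)))).toReal
      ^ (1 / ((n : ℝ) + 1))) atTop (nhds (spectralRadius ℂ T).toReal) := by
  have hlow : ∀ n : ℕ, spectralRadius ℂ T
      ≤ eSchur (weightMatrix X ν) (entry (T ^ (n + 1))) ^ (1 / ((n : ℝ) + 1)) := fun n => by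
    have hone : ‖(1 : EllTwo X H →L[ℂ] EllTwo X H)‖₊ ≤ 1 := ContinuousLinearMap.norm_id_le
    calc spectralRadius ℂ T ≤ ‖T ^ (n + 1)‖₊ ^ (1 / (n + 1) : ℝ) *
          ‖(1 : EllTwo X H →L[ℂ] EllTwo X H)‖₊ ^ (1 / (n + 1) : ℝ) :=
          spectrum.spectralRadius_le_pow_nnnorm_pow_one_div ℂ T n
      _ ≤ ‖T ^ (n + 1)‖₊ ^ (1 / (n + 1) : ℝ) * 1 := by
          gcongr
          exact ENNReal.rpow_le_one (by exact_mod_cast hone) (by positivity)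
      _ ≤ _ := by
          rw [mul_one]
          gcongr
          exact hν.enorm_le_eSchur _
  have hpow : ∀ n : ℕ, eSchur (weightMatrix X ν) (entry (T ^ (n + 1))) ^ (1 / ((n : ℝ) + 1)) ≠ ⊤ :=
    fun n => ENNReal.rpow_ne_top_of_nonneg (by positivity) (hν.eSchur_pow_ne_top hT _)
  have hfin : spectralRadius ℂ T ≠ ⊤ := ne_top_of_le_ne_top (hpow 0) (hlow 0)
  refine tendsto_order.2 ⟨fun x hx => .of_forall fun n => hx.trans_le ?_, fun x hx => ?_⟩
  · rw [ENNReal.toReal_rpow]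
    exact ENNReal.toReal_mono (hpow n) (hlow n)
  · obtain ⟨q, hq, hqx⟩ := exists_between hx
    have hq0 : 0 < q := ENNReal.toReal_nonneg.trans_lt hq
    obtain ⟨C, hC, hgr⟩ := hν.schurGrowth hX hδ hC₀ hgrowth hT
      ((ENNReal.lt_ofReal_iff_toReal_lt hfin).2 hq)
    have hinv : Tendsto (fun n : ℕ => 1 / ((n : ℝ) + 1)) atTop (nhds 0) :=
      tendsto_one_div_add_atTop_nhds_zero_nat
    have hlim : Tendsto (fun n : ℕ => (C + 1) ^ (1 / ((n : ℝ) + 1)) * q) atTop (nhds q) := by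
      have h := (Real.continuousAt_const_rpow (a := C + 1) (b := 0) (by positivity)).tendsto
      simpa using (h.comp hinv).mul_const q
    filter_upwards [hlim.eventually (gt_mem_nhds hqx)] with n hn
    refine lt_of_le_of_lt ?_ hn
    calc _ ≤ ((C + 1) * q ^ (n + 1)) ^ (1 / ((n : ℝ) + 1)) := by
          gcongr
          refine ENNReal.toReal_le_of_le_ofReal (by positivity) ((hgr _).trans ?_)
          exact ENNReal.ofReal_le_ofReal (by gcongr; linarith)
      _ = _ := by
          rw [Real.mul_rpow (by positivity) (by positivity)]
          congr 1
          rw [one_div]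
          exact_mod_cast Real.pow_rpow_inv_natCast hq0.le n.succ_ne_zero

end InverseClosed

theorem statement12 {d : ℕ} (X : Set (Euc d)) (hX : RelSep X)
    (H : Type*) [NormedAddCommGroup H] [InnerProductSpace ℂ H] [CompleteSpace H]
    [TopologicalSpace.SeparableSpace H]
    (ν : Euc d → ℝ) (hνc : Continuous ν) (hνpos : ∀ x, 0 < ν x) (hν : Admissible ν)
    (δ C₀ : ℝ) (hδ0 : 0 < δ) (hδ1 : δ ≤ 1) (hC₀ : 0 < C₀)
    (hgrowth : ∀ x : Euc d, C₀ * (1 + ‖x‖) ^ δ ≤ ν x)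
    (A : ↥X → ↥X → (H →L[ℂ] H)) (hA : MemSchur1 ν A)
    (T : lp (fun _ : ↥X => H) 2 →L[ℂ] lp (fun _ : ↥X => H) 2)
    (hT : ∀ (f : lp (fun _ : ↥X => H) 2) (k : ↥X), T f k = ∑' l : ↥X, A k l (f l)) :
    ((∀ k l : ↥X, A l k = ContinuousLinearMap.adjoint (A k l)) →
      ∃ r : ℝ,
        Tendsto (fun n : ℕ => (schurNorm1 ν (matPow A n)) ^ (1 / ((n : ℝ) + 1)))
          atTop (nhds r) ∧
        ENNReal.ofReal r = spectralRadius ℂ T) ∧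
    (∀ S : lp (fun _ : ↥X => H) 2 →L[ℂ] lp (fun _ : ↥X => H) 2,
      S.comp T = ContinuousLinearMap.id ℂ _ →
      T.comp S = ContinuousLinearMap.id ℂ _ →
      ∃ B : ↥X → ↥X → (H →L[ℂ] H),
        (∀ (k l : ↥X) (f : H), B k l f = (S (deltaSeq 2 l f)) k) ∧
        MemSchur1 ν B) := by
  obtain rfl : entry T = A := entry_eq_of_apply_eq_tsum hT
  have hfin : eSchur (weightMatrix X ν) (entry T) ≠ ⊤ :=
    (eSchur_weightMatrix_ne_top_iff hν.nonneg _).2 hA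
  refine ⟨fun _ => ⟨(spectralRadius ℂ T).toReal, ?_, ?_⟩, fun S hST hTS =>
    ⟨entry S, fun _ _ _ => rfl, (eSchur_weightMatrix_ne_top_iff hν.nonneg _).1
      (hν.eSchur_inverse_ne_top hX hδ0 hC₀ hgrowth hfin hST hTS)⟩⟩
  · convert hν.tendsto_eSchur_pow hX hδ0 hC₀ hgrowth hfin using 3 with n
    rw [hν.matPow_entry hfin, schurNorm1_eq_toReal hν.nonneg (hν.eSchur_pow_ne_top hfin _)]
  · have hle : spectralRadius ℂ T ≤ _ := spectrum.spectralRadius_le_pow_nnnorm_pow_one_div ℂ T 0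
    refine ENNReal.ofReal_toReal (ne_top_of_le_ne_top ?_ hle)
    exact ENNReal.mul_ne_top (ENNReal.rpow_ne_top_of_nonneg (by positivity) ENNReal.coe_ne_top)
      (ENNReal.rpow_ne_top_of_nonneg (by positivity) ENNReal.coe_ne_top)
end
end

section
/- Let X ⊂ ℝ^d be a relatively separated set and ν an admissible weight. Define the J_ν-norm of a B(H)-valued matrix A = [A_{k,l}]_{k,l∈X} by ‖A‖_{J_ν} = sup_{k,l∈X} ‖A_{k,l}‖ ν(k−l). (i) If sup_{k∈X} Σ_{l∈X} ν(k−l)^{−1} < ∞, then there exists C₁ > 0 such that every A with ‖A‖_{J_ν} < ∞ has finite unweighted Schur norm with ‖A‖_{S^1} ≤ C₁ ‖A‖_{J_ν}. (ii) If additionally there exists C > 0 with Σ_{n∈X} ν(k−n)^{−1} ν(n−l)^{−1} < C ν(k−l)^{−1} for all k,l ∈ X, then for all A, B with finite J_ν-norm the product matrix AB (entrywise absolutely convergent) satisfies ‖AB‖_{J_ν} ≤ C' ‖A‖_{J_ν} ‖B‖_{J_ν} for a constant C' independent of A and B. -/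
open scoped ENNReal
open Set Filter

noncomputable section

/-- The `J_ν`-norm `sup_{k,l ∈ X} ‖A_{k,l}‖ ν(k-l)`. -/
noncomputable def jnuNorm {d : ℕ} {X : Set (Euc d)} {H : Type*}
    [NormedAddCommGroup H] [InnerProductSpace ℂ H]
    (ν : Euc d → ℝ) (A : ↥X → ↥X → (H →L[ℂ] H)) : ℝ :=
  ⨆ q : ↥X × ↥X, ‖A q.1 q.2‖ * ν ((q.1 : Euc d) - (q.2 : Euc d))

/-- The unweighted Schur norm `‖A‖_{S^1}`. -/
noncomputable def schurNormUnweighted {d : ℕ} {X : Set (Euc d)} {H : Type*}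
    [NormedAddCommGroup H] [InnerProductSpace ℂ H]
    (A : ↥X → ↥X → (H →L[ℂ] H)) : ℝ :=
  max (⨆ k : ↥X, ∑' l : ↥X, ‖A k l‖) (⨆ l : ↥X, ∑' k : ↥X, ‖A k l‖)

theorem IsNormOn.map_sub_comm {d : ℕ} {nrm : Euc d → ℝ} (h : IsNormOn nrm) (x y : Euc d) :
    nrm (x - y) = nrm (y - x) := by
  have := h.2.2.1 (-1) (y - x)
  simpa using this

theorem Admissible.map_sub_comm {d : ℕ} {ν : Euc d → ℝ} (h : Admissible ν) (x y : Euc d) :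
    ν (x - y) = ν (y - x) := by
  obtain ⟨⟨ρ, nrm, hn, -, -, -, -, hν⟩, -⟩ := h
  rw [hν, hν, hn.map_sub_comm]

section JNu

variable {d : ℕ} {X : Set (Euc d)} {H : Type*} [NormedAddCommGroup H] [InnerProductSpace ℂ H]
  {ν : Euc d → ℝ}

theorem jnuNorm_nonneg (hν : ∀ x, 0 < ν x) (A : ↥X → ↥X → (H →L[ℂ] H)) : 0 ≤ jnuNorm ν A :=
  Real.iSup_nonneg fun _ => mul_nonneg (norm_nonneg _) (hν _).le

theorem norm_le_jnuNorm_mul_inv (hν : ∀ x, 0 < ν x) {A : ↥X → ↥X → (H →L[ℂ] H)}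
    (hA : BddAbove (Set.range fun q : ↥X × ↥X =>
      ‖A q.1 q.2‖ * ν ((q.1 : Euc d) - (q.2 : Euc d)))) (k l : ↥X) :
    ‖A k l‖ ≤ jnuNorm ν A * (ν ((k : Euc d) - (l : Euc d)))⁻¹ :=
  (le_mul_inv_iff₀ (hν _)).2 (le_ciSup hA (k, l))

end JNu

theorem summable_and_tsum_le_of_le_mul {ι : Type*} {f w : ι → ℝ} {J M : ℝ} (hf : ∀ i, 0 ≤ f i)
    (hJ : 0 ≤ J) (hle : ∀ i, f i ≤ J * w i) (hw : Summable w) (hM : ∑' i, w i ≤ M) :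
    Summable f ∧ ∑' i, f i ≤ M * J := by
  have hJw := hw.mul_left J
  have hs := Summable.of_nonneg_of_le hf hle hJw
  refine ⟨hs, (hs.tsum_le_tsum hle hJw).trans ?_⟩
  rw [tsum_mul_left, mul_comm M]
  exact mul_le_mul_of_nonneg_left hM hJ

theorem statement13 {d : ℕ} (X : Set (Euc d)) (hX : RelSep X)
    (H : Type*) [NormedAddCommGroup H] [InnerProductSpace ℂ H] [CompleteSpace H]
    [TopologicalSpace.SeparableSpace H]
    (ν : Euc d → ℝ) (hνc : Continuous ν) (hνpos : ∀ x, 0 < ν x) (hν : Admissible ν) :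
    -- (i)
    (((∀ k : ↥X, Summable fun l : ↥X => (ν ((k : Euc d) - (l : Euc d)))⁻¹) ∧
      BddAbove (Set.range fun k : ↥X => ∑' l : ↥X, (ν ((k : Euc d) - (l : Euc d)))⁻¹)) →
      ∃ C₁ > 0, ∀ A : ↥X → ↥X → (H →L[ℂ] H),
        BddAbove (Set.range fun q : ↥X × ↥X =>
          ‖A q.1 q.2‖ * ν ((q.1 : Euc d) - (q.2 : Euc d))) →
        (∀ k : ↥X, Summable fun l : ↥X => ‖A k l‖) ∧
        BddAbove (Set.range fun k : ↥X => ∑' l : ↥X, ‖A k l‖) ∧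
        (∀ l : ↥X, Summable fun k : ↥X => ‖A k l‖) ∧
        BddAbove (Set.range fun l : ↥X => ∑' k : ↥X, ‖A k l‖) ∧
        schurNormUnweighted A ≤ C₁ * jnuNorm ν A) ∧
    -- (ii)
    (((∀ k : ↥X, Summable fun l : ↥X => (ν ((k : Euc d) - (l : Euc d)))⁻¹) ∧
      BddAbove (Set.range fun k : ↥X => ∑' l : ↥X, (ν ((k : Euc d) - (l : Euc d)))⁻¹)) →
      ∀ C > 0,
      (∀ k l : ↥X,
        Summable (fun n : ↥X =>
          (ν ((k : Euc d) - (n : Euc d)))⁻¹ * (ν ((n : Euc d) - (l : Euc d)))⁻¹) ∧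
        ∑' n : ↥X, (ν ((k : Euc d) - (n : Euc d)))⁻¹ * (ν ((n : Euc d) - (l : Euc d)))⁻¹ <
          C * (ν ((k : Euc d) - (l : Euc d)))⁻¹) →
      ∃ C' > 0, ∀ A B : ↥X → ↥X → (H →L[ℂ] H),
        BddAbove (Set.range fun q : ↥X × ↥X =>
          ‖A q.1 q.2‖ * ν ((q.1 : Euc d) - (q.2 : Euc d))) →
        BddAbove (Set.range fun q : ↥X × ↥X =>
          ‖B q.1 q.2‖ * ν ((q.1 : Euc d) - (q.2 : Euc d))) →
        (∀ k l : ↥X, Summable fun n : ↥X => ‖(A k n) ∘L (B n l)‖) ∧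
        ∀ k l : ↥X,
          ‖∑' n : ↥X, (A k n) ∘L (B n l)‖ * ν ((k : Euc d) - (l : Euc d)) ≤
            C' * jnuNorm ν A * jnuNorm ν B) := by
  constructor
  · rintro ⟨hs, M, hM⟩
    have hM' (k : ↥X) : ∑' l : ↥X, (ν ((k : Euc d) - (l : Euc d)))⁻¹ ≤ max M 1 :=
      (hM (mem_range_self k)).trans (le_max_left _ _)
    refine ⟨max M 1, by positivity, fun A hA => ?_⟩
    have hJ := jnuNorm_nonneg hνpos A
    have hle := norm_le_jnuNorm_mul_inv hνpos hA
    have row (k : ↥X) := summable_and_tsum_le_of_le_mul (fun l => norm_nonneg (A k l)) hJ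
      (hle k) (hs k) (hM' k)
    have col (l : ↥X) := summable_and_tsum_le_of_le_mul (fun k => norm_nonneg (A k l)) hJ
      (fun k => by rw [hν.map_sub_comm]; exact hle k l) (hs l) (hM' l)
    have hMJ : 0 ≤ max M 1 * jnuNorm ν A := by positivity
    exact ⟨fun k => (row k).1, ⟨_, forall_mem_range.2 fun k => (row k).2⟩,
      fun l => (col l).1, ⟨_, forall_mem_range.2 fun l => (col l).2⟩,
      max_le (Real.iSup_le (fun k => (row k).2) hMJ) (Real.iSup_le (fun l => (col l).2) hMJ)⟩
  · rintro - C hC hconv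
    refine ⟨C, hC, fun A B hA hB => ?_⟩
    have hJ := mul_nonneg (jnuNorm_nonneg hνpos A) (jnuNorm_nonneg hνpos B)
    have key (k l : ↥X) := summable_and_tsum_le_of_le_mul
      (fun n => norm_nonneg ((A k n) ∘L (B n l))) hJ
      (fun n => ((A k n).opNorm_comp_le (B n l)).trans <|
        (mul_le_mul (norm_le_jnuNorm_mul_inv hνpos hA k n) (norm_le_jnuNorm_mul_inv hνpos hB n l)
          (norm_nonneg _) (mul_nonneg (jnuNorm_nonneg hνpos A) (inv_pos.2 (hνpos _)).le)).trans_eq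
          (mul_mul_mul_comm _ _ _ _))
      (hconv k l).1 (hconv k l).2.le
    refine ⟨fun k l => (key k l).1, fun k l => ?_⟩
    rw [← le_div_iff₀ (hνpos _)]
    refine (norm_tsum_le_tsum_norm (key k l).1).trans ((key k l).2.trans_eq ?_)
    rw [div_eq_mul_inv]
    ring
end
end
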